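/- arXiv:1412.5085 — 3 statements merged into one kernel-verified Lean document; each statement's English description precedes it below -/
import Mathlib

section
/- Under the standing assumptions (fixed 0<ε<1/4, n^{1/2−o(1)} < k < sqrt((1/4−ε)·n·log n), Λ(Δ) < o(1) a.s., and φ ≤ φ*), with w̄ = max{φ²k²/n, 6·log n} and q̄ = (1 + 2k²w̄/(q·n²))·q: (a) if x ∈ [n] and A = {A_1,…,A_d} is a family of k-subsets of [n] all containing x such that every z ≠ x lies in at most 8 members of A and fewer than w̄ vertices z ≠ x lie in at least 2 members of A, then for B uniform among the k-subsets of [n] not containing x, Pr(B ∩ A_i ≠ ∅ for all i ∈ [d]) < (1+o(1))·q̄^d; (b) the same conclusion holds if A consists of k-sets containing x but not y (for some y ≠ x) satisfying the same two conditions, and B is uniform among the k-sets containing y but not x. The o(1) is uniform over all choices of x, d, A (and y) satisfying the hypotheses. -/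
open Filter

noncomputable section

/-- The collection of all `k`-element subsets of `Fin n`. -/
def kSets (n k : ℕ) : Finset (Finset (Fin n)) := Finset.powersetCard k Finset.univ

open Classical in
/-- The probability that the random hypergraph `H_k(n,p)` (each `k`-subset of `[n]`
present independently with probability `p`) satisfies the property `P`. -/
def hprob (n k : ℕ) (p : ℝ) (P : Finset (Finset (Fin n)) → Prop) : ℝ :=
  ∑ H ∈ (kSets n k).powerset,
    if P H then p ^ H.card * (1 - p) ^ ((kSets n k).card - H.card) else 0

/-- A family of sets is intersecting (a clique) if no two of its members are disjoint. -/
def IsClique {n : ℕ} (C : Finset (Finset (Fin n))) : Prop :=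
  ∀ A ∈ C, ∀ B ∈ C, (A ∩ B).Nonempty

/-- The star of `x` in `H`: the set of edges of `H` containing `x`. -/
def starOf {n : ℕ} (H : Finset (Finset (Fin n))) (x : Fin n) : Finset (Finset (Fin n)) :=
  H.filter (fun A => x ∈ A)

/-- The degree of `x` in `H`. -/
def vdeg {n : ℕ} (H : Finset (Finset (Fin n))) (x : Fin n) : ℕ := (starOf H x).card

/-- The maximum degree of `H`. -/
def maxDegree {n : ℕ} (H : Finset (Finset (Fin n))) : ℕ :=
  Finset.univ.sup (vdeg H)

/-- A family is nontrivial if it is not contained in a star. -/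
def IsNontrivial {n : ℕ} (C : Finset (Finset (Fin n))) : Prop :=
  ¬ ∃ x : Fin n, ∀ A ∈ C, x ∈ A

/-- `H` satisfies (strong) EKR if every maximum-size intersecting subfamily of `H`
is a star of `H`. -/
def EKR {n : ℕ} (H : Finset (Finset (Fin n))) : Prop :=
  ∀ C ⊆ H, IsClique C → (∀ D ⊆ H, IsClique D → D.card ≤ C.card) →
    ∃ x : Fin n, C = starOf H x

open Classical in
/-- `q = q(n,k)`: the probability that two independent uniform `k`-subsets of `[n]` meet. -/
def interProb (n k : ℕ) : ℝ :=
  ((((kSets n k) ×ˢ (kSets n k)).filter fun AB => (AB.1 ∩ AB.2).Nonempty).card : ℝ) /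
    ((kSets n k).card : ℝ) ^ 2

/-- `φ = p·C(n-1,k-1)`, the expected degree of a vertex. -/
def phi (n k : ℕ) (p : ℝ) : ℝ := p * ((n - 1).choose (k - 1) : ℝ)

/-- `μ̄ = φ·n/k`, the expected number of edges. -/
def mubar (n k : ℕ) (p : ℝ) : ℝ := phi n k p * n / k

/-- The generalized binomial coefficient `C(x,t) = x(x-1)⋯(x-t+1)/t!`. -/
def gchoose (x : ℝ) (t : ℕ) : ℝ := (∏ i ∈ Finset.range t, (x - i)) / (t.factorial : ℝ)

/-- `Λ(t) = C(μ̄,t)·q^{C(t,2)}`. -/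
def Lam (n k : ℕ) (p : ℝ) (t : ℕ) : ℝ :=
  gchoose (mubar n k p) t * interProb n k ^ t.choose 2

/-- `Λ'(t)`: equals `0` for `t ≤ 2` and `Λ(t)` otherwise. -/
def Lam' (n k : ℕ) (p : ℝ) (t : ℕ) : ℝ := if t ≤ 2 then 0 else Lam n k p t

open Classical in
/-- The probability of `E` for a uniform sample from the finite set `s`. -/
def uprob {α : Type*} (s : Finset α) (E : α → Prop) : ℝ :=
  ((s.filter E).card : ℝ) / (s.card : ℝ)

open Classical in
/-- The probability of `E` under the probability mass function `w` on `Ω`. -/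
def wprob {Ω : Type*} [Fintype Ω] (w : Ω → ℝ) (E : Ω → Prop) : ℝ :=
  ∑ ω ∈ Finset.univ.filter E, w ω

open Classical in
/-- The probability that the family `{A_1,…,A_m}` formed by `m` independent uniform
`k`-subsets of `[n]` satisfies `P`. -/
def iidprob (n k m : ℕ) (P : Finset (Finset (Fin n)) → Prop) : ℝ :=
  uprob ((Finset.univ : Finset (Fin m → Finset (Fin n))).filter fun f => ∀ i, f i ∈ kSets n k)
    (fun f => P (Finset.image f Finset.univ))

open Classical in
/-- The probability that the tuple `(A_1,…,A_m)` of independent uniform `k`-subsets of `[n]`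
satisfies `P`. -/
def tupleProb (n k m : ℕ) (P : (Fin m → Finset (Fin n)) → Prop) : ℝ :=
  uprob ((Finset.univ : Finset (Fin m → Finset (Fin n))).filter fun f => ∀ i, f i ∈ kSets n k) P

/-- `Pr(Bin(M,p) ≥ θ)`. -/
def binomProbGe (M : ℕ) (p : ℝ) (θ : ℕ) : ℝ :=
  ∑ j ∈ Finset.Icc θ M, (M.choose j : ℝ) * p ^ j * (1 - p) ^ (M - j)

/-- `φ* = log³ n / log(1/q)`. -/
def phiStar (n k : ℕ) : ℝ := (Real.log n) ^ 3 / Real.log (1 / interProb n k)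

/-- `α₁`: the largest integer `t` with `Pr(Bin(C(n-1,k-1),p) ≥ t) ≥ ψ/n`, where `ψ = log n`. -/
def alpha1 (n k : ℕ) (p : ℝ) : ℕ :=
  sSup {t : ℕ | Real.log n / n ≤ binomProbGe ((n - 1).choose (k - 1)) p t}

/-- `α₂ = min{t : Λ(t) ≤ σ}`. -/
def alpha2 (n k : ℕ) (p σn : ℝ) : ℕ := sInf {t : ℕ | Lam n k p t ≤ σn}

/-- `α = max{α₁, α₂}`. -/
def alphaP (n k : ℕ) (p σn : ℝ) : ℕ := max (alpha1 n k p) (alpha2 n k p σn)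

/-- `γ = min{α, φ*/3}`. -/
def gammaP (n k : ℕ) (p σn : ℝ) : ℕ := min (alphaP n k p σn) ⌊phiStar n k / 3⌋₊

/-- `τ = (1-ε)·γ`. -/
def tauP (ε : ℝ) (n k : ℕ) (p σn : ℝ) : ℝ := (1 - ε) * (gammaP n k p σn : ℝ)

/-- `λ = max{√(log n)/log(1/q), 2·√(log n/log(1/q))}`. -/
def lamP (n k : ℕ) : ℝ :=
  max (Real.sqrt (Real.log n) / Real.log (1 / interProb n k))
    (2 * Real.sqrt (Real.log n / Real.log (1 / interProb n k)))

/-- `w̄ = max{φ²k²/n, 6 log n}`. -/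
def wbar (n k : ℕ) (p : ℝ) : ℝ := max (phi n k p ^ 2 * (k : ℝ) ^ 2 / n) (6 * Real.log n)

/-- `q̄ = (1 + 2k²w̄/(q n²))·q`. -/
def qbar (n k : ℕ) (p : ℝ) : ℝ :=
  (1 + 2 * (k : ℝ) ^ 2 * wbar n k p / (interProb n k * (n : ℝ) ^ 2)) * interProb n k

open Classical in
/-- The probability that the random subset of `H`, keeping each element independently
with probability `ρ`, satisfies `P`. -/
def sprob {β : Type*} [DecidableEq β] (H : Finset β) (ρ : ℝ) (P : Finset β → Prop) : ℝ :=
  ∑ G ∈ H.powerset, if P G then ρ ^ G.card * (1 - ρ) ^ (H.card - G.card) else 0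

/-- The degree of `v` in the multiset `{f 0, …, f (m-1)}` (with multiplicity). -/
def tdeg {n m : ℕ} (f : Fin m → Finset (Fin n)) (v : Fin n) : ℕ :=
  (Finset.univ.filter fun i => v ∈ f i).card

/-- An increasing (up-)event in `{0,1}^ι`. -/
def IncrEvent {ι : Type*} (A : Set (ι → Bool)) : Prop :=
  ∀ x y : ι → Bool, y ≤ x → y ∈ A → x ∈ A

/-- The coordinate `i` affects the event `A`. -/
def Affects {ι : Type*} (i : ι) (A : Set (ι → Bool)) : Prop :=
  ∃ η ∈ A, ∃ ν, ν ∉ A ∧ ∀ j, j ≠ i → η j = ν j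

/-- Negative association of a family of `{0,1}`-valued random variables, defined on the
finite probability space `Ω` with probability mass function `w`. -/
def NegAssoc {Ω ι : Type*} [Fintype Ω] (w : Ω → ℝ) (X : ι → Ω → Bool) : Prop :=
  ∀ A B : Set (ι → Bool), IncrEvent A → IncrEvent B →
    (∀ i, ¬ (Affects i A ∧ Affects i B)) →
    wprob w (fun ω => (fun i => X i ω) ∈ A ∧ (fun i => X i ω) ∈ B) ≤
      wprob w (fun ω => (fun i => X i ω) ∈ A) * wprob w (fun ω => (fun i => X i ω) ∈ B)

/-- `X = X_1 + ⋯ + X_m` for `{0,1}`-valued random variables. -/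
def bcount {Ω : Type*} {m : ℕ} (X : Fin m → Ω → Bool) (ω : Ω) : ℕ :=
  (Finset.univ.filter fun i => X i ω = true).card

end


section SAIB
open Classical Finset

/-- number of elements of `s` satisfying `E` -/
noncomputable def saib_cnt {α : Type*} (s : Finset α) (E : α → Prop) : ℕ := (s.filter E).card

theorem saib_cnt_eq {α : Type*} (s : Finset α) (E : α → Prop) [DecidablePred E] :
    saib_cnt s E = (s.filter E).card := by
  unfold saib_cnt
  congr

theorem saib_uprob_eq {α : Type*} (s : Finset α) (E : α → Prop) :
    uprob s E = (saib_cnt s E : ℝ) / (s.card : ℝ) := rfl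

theorem saib_uprob_nonneg {α : Type*} (s : Finset α) (E : α → Prop) : 0 ≤ uprob s E := by
  unfold uprob; positivity

theorem saib_uprob_le_one {α : Type*} (s : Finset α) (E : α → Prop) : uprob s E ≤ 1 := by
  unfold uprob
  apply div_le_one_of_le₀ _ (by positivity)
  exact_mod_cast Finset.card_filter_le _ _

theorem saib_uprob_mono {α : Type*} (s : Finset α) (E F : α → Prop)
    (h : ∀ a ∈ s, E a → F a) : uprob s E ≤ uprob s F := by
  unfold uprob
  apply div_le_div_of_nonneg_right _ (by positivity)
  norm_cast
  apply Finset.card_le_card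
  intro a ha
  simp only [Finset.mem_filter] at ha ⊢
  exact ⟨ha.1, h a ha.1 ha.2⟩

/-- monotone in the size, one step -/
theorem saib_size_step {α : Type*} [DecidableEq α] (V : Finset α) (m : ℕ) (U : Finset α → Prop)
    (hU : ∀ A B, A ⊆ B → U A → U B) (hm : m + 1 ≤ V.card) :
    uprob (V.powersetCard m) U ≤ uprob (V.powersetCard (m+1)) U := by
  unfold uprob
  have h1 : ((V.powersetCard m).filter U).card * (V.card - m)
      ≤ ((V.powersetCard (m+1)).filter U).card * (m + 1) := by
    apply Finset.card_mul_le_card_mul (fun A B => A ⊆ B)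
    · intro A hA
      simp only [Finset.mem_filter, Finset.mem_powersetCard] at hA
      rw [← hA.1.2, ← Finset.card_sdiff_of_subset hA.1.1]
      rw [← Finset.card_image_of_injOn (s := V \ A) (f := fun v => insert v A)]
      · apply Finset.card_le_card
        intro B hB
        simp only [Finset.mem_image, Finset.mem_sdiff] at hB
        obtain ⟨v, ⟨hvV, hvA⟩, rfl⟩ := hB
        simp only [Finset.bipartiteAbove, Finset.mem_filter, Finset.mem_powersetCard]
        refine ⟨⟨⟨Finset.insert_subset hvV hA.1.1, ?_⟩, ?_⟩, Finset.subset_insert _ _⟩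
        · rw [Finset.card_insert_of_notMem hvA]
        · exact hU _ _ (Finset.subset_insert _ _) hA.2
      · intro v hv w hw h
        simp only [Finset.coe_sdiff, Set.mem_sdiff, Finset.mem_coe] at hv hw
        have : v ∈ insert w A := by
          rw [← show insert v A = insert w A from h]; exact Finset.mem_insert_self _ _
        rcases Finset.mem_insert.1 this with h | h
        · exact h
        · exact absurd h hv.2
    · intro B hB
      simp only [Finset.mem_filter, Finset.mem_powersetCard] at hB
      have : (Finset.powersetCard m B).card = m + 1 := by
        rw [Finset.card_powersetCard, hB.1.2, Nat.choose_succ_self_right]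
      rw [← this]
      apply Finset.card_le_card
      intro A hA
      simp only [Finset.bipartiteBelow, Finset.mem_filter, Finset.mem_powersetCard] at hA ⊢
      exact ⟨hA.2, hA.1.1.2⟩
  rw [Finset.card_powersetCard, Finset.card_powersetCard]
  have h2 := Nat.choose_succ_right_eq V.card m
  have hp1 : 0 < V.card.choose m := Nat.choose_pos (by omega)
  have hp2 : 0 < V.card.choose (m+1) := Nat.choose_pos (by omega)
  rw [div_le_div_iff₀ (by exact_mod_cast hp1) (by exact_mod_cast hp2)]
  norm_cast
  apply Nat.le_of_mul_le_mul_right _ (show 0 < m + 1 by omega)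
  rw [mul_assoc, h2]
  calc _ = ((V.powersetCard m).filter U).card * (V.card - m) * V.card.choose m := by ring
    _ ≤ ((V.powersetCard (m+1)).filter U).card * (m + 1) * V.card.choose m :=
        Nat.mul_le_mul_right _ h1
    _ = _ := by ring

theorem saib_size_mono {α : Type*} [DecidableEq α] (V : Finset α) (m j : ℕ) (U : Finset α → Prop)
    (hU : ∀ A B, A ⊆ B → U A → U B) (hm : m + j ≤ V.card) :
    uprob (V.powersetCard m) U ≤ uprob (V.powersetCard (m+j)) U := by
  induction j with
  | zero => exact le_rfl
  | succ j ih => exact (ih (by omega)).trans (saib_size_step V (m+j) U hU (by omega))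

theorem saib_remove_one {α : Type*} [DecidableEq α] (V : Finset α) (v : α) (hv : v ∉ V) (m : ℕ)
    (U : Finset α → Prop)
    (hU : ∀ A B, A ⊆ B → U A → U B) (hUv : ∀ A, U (insert v A) → U A) (hm : m ≤ V.card) :
    uprob ((insert v V).powersetCard m) U ≤ uprob (V.powersetCard m) U := by
  cases m with
  | zero => simp
  | succ m =>
    have hs := saib_size_step V m U hU hm
    unfold uprob at hs ⊢
    rw [Finset.card_powersetCard, Finset.card_powersetCard] at hs
    rw [Finset.card_powersetCard, Finset.card_powersetCard, Finset.card_insert_of_notMem hv]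
    have hp1 : 0 < V.card.choose m := Nat.choose_pos (by omega)
    have hp2 : 0 < V.card.choose (m+1) := Nat.choose_pos (by omega)
    have hc : ((((insert v V).powersetCard (m+1)).filter U).card)
        ≤ ((V.powersetCard (m+1)).filter U).card + ((V.powersetCard m).filter U).card := by
      rw [Finset.powersetCard_succ_insert hv, Finset.filter_union]
      refine (Finset.card_union_le _ _).trans ?_
      refine Nat.add_le_add_left ?_ _
      rw [Finset.filter_image]
      refine (Finset.card_image_le).trans ?_
      apply Finset.card_le_card
      intro A hA
      simp only [Finset.mem_filter] at hA ⊢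
      exact ⟨hA.1, hUv A hA.2⟩
    rw [Nat.choose_succ_succ]
    have hp1' : (0:ℝ) < V.card.choose m := by exact_mod_cast hp1
    have hp2' : (0:ℝ) < V.card.choose (m+1) := by exact_mod_cast hp2
    have hc' : (((((insert v V).powersetCard (m+1)).filter U).card : ℕ) : ℝ)
        ≤ (((V.powersetCard (m+1)).filter U).card : ℝ) + (((V.powersetCard m).filter U).card : ℝ) := by
      exact_mod_cast hc
    rw [div_le_div_iff₀ hp1' hp2'] at hs
    rw [div_le_div_iff₀ (by push_cast; positivity) hp2']
    push_cast
    nlinarith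

theorem saib_remove {α : Type*} [DecidableEq α] (V D : Finset α) (hD : Disjoint D V) (m : ℕ)
    (U : Finset α → Prop)
    (hU : ∀ A B, A ⊆ B → U A → U B) (hUv : ∀ v ∈ D, ∀ A, U (insert v A) → U A)
    (hm : m ≤ V.card) :
    uprob ((D ∪ V).powersetCard m) U ≤ uprob (V.powersetCard m) U := by
  induction D using Finset.induction_on with
  | empty => simp
  | insert v D hv ih =>
    rw [Finset.disjoint_insert_left] at hD
    rw [Finset.insert_union]
    refine (saib_remove_one (D ∪ V) v ?_ m U hU (hUv v (Finset.mem_insert_self _ _)) ?_).trans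
      (ih hD.2 (fun w hw => hUv w (Finset.mem_insert_of_mem hw)))
    · simp [hv, hD.1]
    · exact hm.trans (Finset.card_le_card Finset.subset_union_right)

/-- negative correlation -/
theorem saib_neg {α : Type*} [DecidableEq α] (V D : Finset α) (hD : D ⊆ V) (m : ℕ) (hmV : m ≤ V.card)
    (U : Finset α → Prop)
    (hU : ∀ A B, A ⊆ B → U A → U B) (hUv : ∀ v ∈ D, ∀ A, U (insert v A) → U A) :
    uprob (V.powersetCard m) (fun B => (B ∩ D).Nonempty ∧ U B)
      ≤ uprob (V.powersetCard m) (fun B => (B ∩ D).Nonempty) * uprob (V.powersetCard m) U := by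
  have hcp : 0 < V.card.choose m := Nat.choose_pos hmV
  have hcp' : (0:ℝ) < V.card.choose m := by exact_mod_cast hcp
  have key : ∀ E : Finset α → Prop, saib_cnt (V.powersetCard m) E =
      saib_cnt (V.powersetCard m) (fun B => (B ∩ D).Nonempty ∧ E B)
      + saib_cnt ((V \ D).powersetCard m) E := by
    intro E
    rw [saib_cnt_eq, saib_cnt_eq, saib_cnt_eq]
    rw [← Finset.card_filter_add_card_filter_not (s := (V.powersetCard m).filter E)
      (fun B => (B ∩ D).Nonempty)]
    congr 1
    · congr 1; ext B; simp only [Finset.mem_filter]; tauto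
    · congr 1; ext B
      simp only [Finset.mem_filter, Finset.mem_powersetCard, Finset.not_nonempty_iff_eq_empty,
        ← Finset.disjoint_iff_inter_eq_empty, Finset.subset_sdiff]
      tauto
  have k1 := key U
  have k2 := key (fun _ => True)
  have ht : ∀ s : Finset (Finset α), saib_cnt s (fun _ => True) = s.card := by
    intro s; rw [saib_cnt_eq]; simp
  simp only [and_true, ht, Finset.card_powersetCard] at k2
  by_cases hm : m ≤ (V \ D).card
  · have hr := saib_remove (V \ D) D Finset.disjoint_sdiff m U hU hUv hm
    rw [Finset.union_sdiff_of_subset hD] at hr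
    simp only [saib_uprob_eq] at hr ⊢
    rw [Finset.card_powersetCard, Finset.card_powersetCard] at hr
    rw [Finset.card_powersetCard]
    have hp2 : (0:ℝ) < (V \ D).card.choose m := by exact_mod_cast Nat.choose_pos hm
    rw [div_le_div_iff₀ hcp' hp2] at hr
    rw [div_mul_div_comm, div_le_div_iff₀ hcp' (by positivity)]
    have k1' : (saib_cnt (V.powersetCard m) U : ℝ) =
      saib_cnt (V.powersetCard m) (fun B => (B ∩ D).Nonempty ∧ U B)
      + saib_cnt ((V \ D).powersetCard m) U := by exact_mod_cast k1
    have k2' : ((V.card.choose m : ℕ) : ℝ) =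
      saib_cnt (V.powersetCard m) (fun B => (B ∩ D).Nonempty)
      + ((V \ D).card.choose m : ℕ) := by exact_mod_cast k2
    rw [← mul_assoc]
    refine mul_le_mul_of_nonneg_right ?_ hcp'.le
    nlinarith
  · have : uprob (V.powersetCard m) (fun B => (B ∩ D).Nonempty) = 1 := by
      rw [saib_uprob_eq]
      rw [Nat.choose_eq_zero_of_lt (not_le.1 hm), add_zero] at k2
      rw [Finset.card_powersetCard, ← k2]
      exact div_self hcp'.ne'
    rw [this, one_mul]
    exact saib_uprob_mono _ _ _ (fun _ _ h => h.2)

theorem saib_prod {α ι : Type*} [DecidableEq α] (V : Finset α) (m : ℕ) (hmV : m ≤ V.card) (s : Finset ι)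
    (D : ι → Finset α) (hD : ∀ i ∈ s, D i ⊆ V)
    (hdis : ∀ i ∈ s, ∀ j ∈ s, i ≠ j → Disjoint (D i) (D j)) (r : ℝ)
    (hr : ∀ i ∈ s, uprob (V.powersetCard m) (fun B => (B ∩ D i).Nonempty) ≤ r) :
    uprob (V.powersetCard m) (fun B => ∀ i ∈ s, (B ∩ D i).Nonempty) ≤ r ^ s.card := by
  induction s using Finset.induction_on with
  | empty => simpa using saib_uprob_le_one _ _
  | insert i s hi ih =>
    rw [Finset.card_insert_of_notMem hi, pow_succ']
    have h0 := hr i (Finset.mem_insert_self _ _)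
    have h1 := saib_neg V (D i) (hD i (Finset.mem_insert_self _ _)) m hmV
      (fun B => ∀ i ∈ s, (B ∩ D i).Nonempty)
      (fun A B hAB h i hi => (h i hi).mono (Finset.inter_subset_inter_right hAB))
      (fun v hv A h j hj => by
        have hd := hdis i (Finset.mem_insert_self _ _) j (Finset.mem_insert_of_mem hj)
          (by rintro rfl; exact hi hj)
        rw [Finset.disjoint_left] at hd
        have h' := h j hj
        rwa [Finset.insert_inter_of_notMem (hd hv)] at h')
    have h2 := ih (fun j hj => hD j (Finset.mem_insert_of_mem hj))
      (fun j hj j' hj' => hdis j (Finset.mem_insert_of_mem hj) j' (Finset.mem_insert_of_mem hj'))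
      (fun j hj => hr j (Finset.mem_insert_of_mem hj))
    simp only [Finset.forall_mem_insert]
    refine h1.trans ?_
    exact mul_le_mul h0 h2 (saib_uprob_nonneg _ _) ((saib_uprob_nonneg _ _).trans h0)

theorem saib_choose_ratio (N m j : ℕ) (hm : m ≤ N) (hj : j ≤ m) :
    (N - j).choose (m - j) * N ^ j ≤ N.choose m * m ^ j := by
  induction j with
  | zero => simp
  | succ j ih =>
    have ih := ih (by omega)
    have e := Nat.add_one_mul_choose_eq (N - (j+1)) (m - (j+1))
    have e1 : N - (j+1) + 1 = N - j := by omega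
    have e2 : m - (j+1) + 1 = m - j := by omega
    rw [e1, e2] at e
    have hpos : 0 < N - j := by omega
    apply Nat.le_of_mul_le_mul_left _ hpos
    have h3 : (m - j) * N ≤ m * (N - j) := by
      zify [show j ≤ m by omega, show j ≤ N by omega]
      have : (m:ℤ) ≤ N := by exact_mod_cast hm
      have : (0:ℤ) ≤ j := by positivity
      nlinarith
    calc (N - j) * ((N - (j+1)).choose (m - (j+1)) * N ^ (j+1))
        = ((N - j) * (N - (j+1)).choose (m - (j+1))) * N ^ (j+1) := by ring
      _ = ((N-j).choose (m-j) * N ^ j) * ((m - j) * N) := by rw [e]; ring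
      _ ≤ (N.choose m * m ^ j) * (m * (N - j)) := Nat.mul_le_mul ih h3
      _ = _ := by ring

theorem saib_main {α ι : Type*} [DecidableEq α] (V W : Finset α) (hW : W ⊆ V) (m : ℕ)
    (hm : m ≤ (V \ W).card) (s : Finset ι)
    (D : ι → Finset α) (hD : ∀ i ∈ s, D i ⊆ V)
    (hdis : ∀ i ∈ s, ∀ j ∈ s, i ≠ j → Disjoint (D i \ W) (D j \ W))
    (hdeg : ∀ v ∈ W, (s.filter (fun i => v ∈ D i)).card ≤ 8) (r : ℝ) (hr0 : 0 < r) (hr1 : r ≤ 1)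
    (hr : ∀ i ∈ s, uprob ((V \ W).powersetCard m) (fun B => (B ∩ (D i \ W)).Nonempty) ≤ r) :
    uprob (V.powersetCard m) (fun B => ∀ i ∈ s, (B ∩ D i).Nonempty) ≤
      r ^ s.card * (1 + (r ^ 8)⁻¹ * (m / V.card)) ^ W.card := by
  have hmV : m ≤ V.card := hm.trans (Finset.card_le_card Finset.sdiff_subset)
  have hcp : (0:ℝ) < V.card.choose m := by exact_mod_cast Nat.choose_pos hmV
  rcases Nat.eq_zero_or_pos V.card with hV0 | hV0
  · have hm0 : m = 0 := by omega
    have hW0 : W.card = 0 := by have := Finset.card_le_card hW; omega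
    subst hm0
    rw [hW0, pow_zero, mul_one]
    have hWe : W = ∅ := Finset.card_eq_zero.1 hW0
    subst hWe
    simp only [Finset.sdiff_empty] at hr hdis
    exact saib_prod V 0 hmV s D hD hdis r hr
  have hVp : (0:ℝ) < V.card := by exact_mod_cast hV0
  have step : ∀ T ∈ W.powerset,
      (((V.powersetCard m).filter (fun B => ∀ i ∈ s, (B ∩ D i).Nonempty)).filter
        (fun B => B ∩ W = T)).card ≤
      (r ^ s.card * V.card.choose m) * ((r^8)⁻¹ * (m / V.card)) ^ T.card := by
    intro T hT
    rw [Finset.mem_powerset] at hT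
    by_cases hTm : T.card ≤ m
    · set s' := s.filter (fun i => ¬ (T ∩ D i).Nonempty) with hs'
      have hle : (((V.powersetCard m).filter (fun B => ∀ i ∈ s, (B ∩ D i).Nonempty)).filter
        (fun B => B ∩ W = T)).card ≤ saib_cnt ((V \ W).powersetCard (m - T.card))
          (fun B => ∀ i ∈ s', (B ∩ (D i \ W)).Nonempty) := by
        rw [saib_cnt_eq]
        apply Finset.card_le_card_of_injOn (fun B => B \ W)
        · intro B hB
          simp only [Finset.coe_filter, Finset.mem_filter, Finset.mem_powersetCard,
            Set.mem_ofPred_eq] at hB ⊢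
          obtain ⟨⟨⟨hBV, hBm⟩, hBh⟩, hBT⟩ := hB
          refine ⟨⟨Finset.sdiff_subset_sdiff hBV le_rfl, ?_⟩, ?_⟩
          · have := Finset.card_sdiff_add_card_inter B W
            rw [hBT] at this; omega
          · intro i hi
            rw [hs', Finset.mem_filter] at hi
            obtain ⟨v, hv⟩ := hBh i hi.1
            rw [Finset.mem_inter] at hv
            refine ⟨v, ?_⟩
            have hvW : v ∉ W := by
              intro hvW
              apply hi.2
              refine ⟨v, Finset.mem_inter.2 ⟨?_, hv.2⟩⟩
              rw [← hBT]; exact Finset.mem_inter.2 ⟨hv.1, hvW⟩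
            simp [hv.1, hv.2, hvW]
        · intro B hB B' hB' h
          simp only [Finset.coe_filter, Finset.mem_filter, Set.mem_ofPred_eq] at hB hB'
          rw [← Finset.sdiff_union_inter B W, ← Finset.sdiff_union_inter B' W, hB.2, hB'.2]
          simp only at h
          rw [h]
      have hp : uprob ((V \ W).powersetCard (m - T.card))
          (fun B => ∀ i ∈ s', (B ∩ (D i \ W)).Nonempty) ≤ r ^ s'.card := by
        refine (saib_size_mono (V \ W) (m - T.card) T.card _ ?_ (by omega)).trans ?_
        · intro A B hAB h i hi
          exact (h i hi).mono (Finset.inter_subset_inter_right hAB)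
        · rw [Nat.sub_add_cancel hTm]
          have hss : s' ⊆ s := Finset.filter_subset _ _
          exact saib_prod (V \ W) m hm s' (fun i => D i \ W)
            (fun i hi => Finset.sdiff_subset_sdiff (hD i (hss hi)) le_rfl)
            (fun i hi j hj => hdis i (hss hi) j (hss hj)) r (fun i hi => hr i (hss hi))
      have hcard : s.card ≤ s'.card + 8 * T.card := by
        have h1 : (s.filter (fun i => (T ∩ D i).Nonempty)).card + s'.card = s.card := by
          rw [hs']
          convert Finset.card_filter_add_card_filter_not (s := s) (fun i => (T ∩ D i).Nonempty)
        have h2 : (s.filter (fun i => (T ∩ D i).Nonempty)).card ≤ T.card * 8 := by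
          have : s.filter (fun i => (T ∩ D i).Nonempty) ⊆
              T.biUnion (fun v => s.filter (fun i => v ∈ D i)) := by
            intro i hi
            rw [Finset.mem_filter] at hi
            obtain ⟨v, hv⟩ := hi.2
            rw [Finset.mem_inter] at hv
            rw [Finset.mem_biUnion]
            exact ⟨v, hv.1, Finset.mem_filter.2 ⟨hi.1, hv.2⟩⟩
          refine (Finset.card_le_card this).trans ?_
          exact Finset.card_biUnion_le_card_mul _ _ _ (fun v hv => hdeg v (hT hv))
        omega
      have hrp : r ^ s'.card ≤ r ^ s.card * ((r^8)⁻¹) ^ T.card := by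
        rw [inv_pow, ← div_eq_mul_inv, le_div_iff₀ (by positivity), ← pow_mul, ← pow_add]
        exact pow_le_pow_of_le_one hr0.le hr1 hcard
      have hch : ((V \ W).card.choose (m - T.card) : ℝ) ≤
          V.card.choose m * ((m : ℝ) / V.card) ^ T.card := by
        rw [div_pow, mul_div_assoc', le_div_iff₀ (by positivity)]
        have h1 := saib_choose_ratio V.card m T.card hmV hTm
        have h2 : (V \ W).card.choose (m - T.card) ≤ (V.card - T.card).choose (m - T.card) := by
          apply Nat.choose_le_choose
          rw [Finset.card_sdiff_of_subset hW]
          have := Finset.card_le_card hT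
          omega
        have h3 := (Nat.mul_le_mul_right (V.card ^ T.card) h2).trans h1
        exact_mod_cast h3
      rw [saib_uprob_eq] at hp
      rw [Finset.card_powersetCard] at hp
      have hpos : (0:ℝ) < (V \ W).card.choose (m - T.card) := by
        exact_mod_cast Nat.choose_pos (by omega)
      rw [div_le_iff₀ hpos] at hp
      calc _ ≤ (saib_cnt ((V \ W).powersetCard (m - T.card))
          (fun B => ∀ i ∈ s', (B ∩ (D i \ W)).Nonempty) : ℝ) := by exact_mod_cast hle
        _ ≤ _ := hp
        _ ≤ (r ^ s.card * ((r^8)⁻¹) ^ T.card) * (V.card.choose m * ((m : ℝ) / V.card) ^ T.card) :=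
            mul_le_mul hrp hch hpos.le (by positivity)
        _ = _ := by rw [mul_pow]; ring
    · rw [Finset.filter_eq_empty_iff.2]
      · simp only [Finset.card_empty, Nat.cast_zero]; positivity
      · intro B hB hBT
        simp only [Finset.mem_filter, Finset.mem_powersetCard] at hB
        have := Finset.card_le_card (Finset.inter_subset_left (s₁ := B) (s₂ := W))
        rw [hBT] at this
        omega
  rw [saib_uprob_eq, saib_cnt_eq]
  rw [Finset.card_powersetCard, div_le_iff₀ hcp]
  rw [Finset.card_eq_sum_card_fiberwise (f := fun B => B ∩ W) (t := W.powerset)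
    (fun B _ => by simp)]
  push_cast
  refine (Finset.sum_le_sum step).trans ?_
  rw [← Finset.mul_sum]
  have := Finset.sum_pow_mul_eq_add_pow ((r^8)⁻¹ * ((m:ℝ) / V.card)) 1 W
  simp only [one_pow, mul_one] at this
  rw [this, add_comm]
  apply le_of_eq; ring

theorem saib_hit_cnt {α : Type*} [DecidableEq α] (V D : Finset α) (hD : D ⊆ V) (m : ℕ) :
    saib_cnt (V.powersetCard m) (fun B => (B ∩ D).Nonempty) + (V.card - D.card).choose m
      = V.card.choose m := by
  rw [saib_cnt_eq, ← Finset.card_powersetCard m V, ← Finset.card_sdiff_of_subset hD,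
    ← Finset.card_powersetCard m (V \ D),
    ← Finset.card_filter_add_card_filter_not (s := (V.powersetCard m)) (fun B => (B ∩ D).Nonempty)]
  congr 2
  ext B
  simp only [Finset.mem_filter, Finset.mem_powersetCard, Finset.not_nonempty_iff_eq_empty,
        ← Finset.disjoint_iff_inter_eq_empty, Finset.subset_sdiff]
  tauto

theorem saib_hit {α : Type*} [DecidableEq α] (V D : Finset α) (hD : D ⊆ V) (m : ℕ)
    (hm : m ≤ V.card) :
    uprob (V.powersetCard m) (fun B => (B ∩ D).Nonempty)
      = 1 - ((V.card - D.card).choose m : ℝ) / (V.card.choose m : ℝ) := by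
  have hcp : (0:ℝ) < V.card.choose m := by exact_mod_cast Nat.choose_pos hm
  have h : (saib_cnt (V.powersetCard m) (fun B => (B ∩ D).Nonempty) : ℝ) +
    ((V.card - D.card).choose m : ℕ) = (V.card.choose m : ℕ) := by
    exact_mod_cast saib_hit_cnt V D hD m
  rw [saib_uprob_eq, Finset.card_powersetCard]
  field_simp
  linarith

theorem saib_interProb (n k : ℕ) (hk : k ≤ n) :
    interProb n k = 1 - ((n - k).choose k : ℝ) / (n.choose k : ℝ) := by
  have hcp : (0:ℝ) < n.choose k := by exact_mod_cast Nat.choose_pos hk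
  have hc : (((kSets n k) ×ˢ (kSets n k)).filter fun AB => (AB.1 ∩ AB.2).Nonempty).card
      + n.choose k * (n - k).choose k = n.choose k * n.choose k := by
    have h1 : (((kSets n k) ×ˢ (kSets n k)).filter fun AB => (AB.1 ∩ AB.2).Nonempty).card
        = ∑ A ∈ kSets n k, saib_cnt (kSets n k) (fun B => (B ∩ A).Nonempty) := by
      rw [Finset.card_filter, Finset.sum_product]
      apply Finset.sum_congr rfl
      intro A _
      rw [saib_cnt_eq, Finset.card_filter]
      apply Finset.sum_congr rfl
      intro B _
      simp only [Finset.inter_comm]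
    have hcard : (kSets n k).card = n.choose k := by simp [kSets]
    have h2 : ∑ A ∈ kSets n k, (n - k).choose k = n.choose k * (n-k).choose k := by
      rw [Finset.sum_const, hcard, smul_eq_mul]
    rw [h1, ← h2, ← Finset.sum_add_distrib]
    rw [Finset.sum_congr rfl (g := fun _ => n.choose k), Finset.sum_const, hcard, smul_eq_mul]
    intro A hA
    simp only [kSets, Finset.mem_powersetCard] at hA
    have := saib_hit_cnt (Finset.univ : Finset (Fin n)) A (Finset.subset_univ _) k
    rw [hA.2, Finset.card_univ, Fintype.card_fin] at this
    exact this
  unfold interProb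
  have hcard : (kSets n k).card = n.choose k := by simp [kSets]
  rw [hcard]
  have hc' : ((((kSets n k) ×ˢ (kSets n k)).filter fun AB => (AB.1 ∩ AB.2).Nonempty).card : ℝ)
      + n.choose k * (n - k).choose k = n.choose k * n.choose k := by exact_mod_cast hc
  have hc'' : ((((kSets n k) ×ˢ (kSets n k)).filter fun AB => (AB.1 ∩ AB.2).Nonempty).card : ℝ)
      = n.choose k * n.choose k - n.choose k * (n - k).choose k := by linarith
  have e : ∀ a : ℝ, a = n.choose k * n.choose k - n.choose k * (n - k).choose k →
      a / (n.choose k : ℝ)^2 = 1 - ((n - k).choose k : ℝ) / (n.choose k : ℝ) := by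
    intro a ha
    rw [ha]; field_simp
  apply e
  rw [← hc'']

theorem saib_gstep (M s m : ℕ) (h : s + m ≤ M) :
    ((M + 1 - s).choose m : ℝ) / ((M+1).choose m : ℝ) - ((M - s).choose m : ℝ) / (M.choose m : ℝ)
      ≤ (s : ℝ) * m / (((M:ℝ) + 1 - s) * ((M:ℝ) + 1 - m)) := by
  have e1 := Nat.choose_mul_succ_eq M m
  have e2 := Nat.choose_mul_succ_eq (M - s) m
  have hs1 : M - s + 1 = M + 1 - s := by omega
  rw [hs1] at e2
  have p1 : (0:ℝ) < M.choose m := by exact_mod_cast Nat.choose_pos (by omega)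
  have p2 : (0:ℝ) < (M+1).choose m := by exact_mod_cast Nat.choose_pos (by omega)
  have c1 : ((M + 1 - m : ℕ) : ℝ) = (M:ℝ) + 1 - m := by
    rw [Nat.cast_sub (by omega)]; push_cast; ring
  have c2 : ((M + 1 - s : ℕ) : ℝ) = (M:ℝ) + 1 - s := by
    rw [Nat.cast_sub (by omega)]; push_cast; ring
  have c3 : ((M + 1 - s - m : ℕ) : ℝ) = (M:ℝ) + 1 - s - m := by
    rw [Nat.cast_sub (by omega), c2]
  have E1 : (M.choose m : ℝ) * (M + 1) = (M+1).choose m * ((M:ℝ) + 1 - m) := by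
    rw [← c1]; exact_mod_cast e1
  have E2 : ((M-s).choose m : ℝ) * ((M:ℝ) + 1 - s) = (M+1-s).choose m * ((M:ℝ) + 1 - s - m) := by
    rw [← c3, ← c2]; exact_mod_cast e2
  have hM : (s:ℝ) + m ≤ M := by exact_mod_cast h
  have hs0 : (0:ℝ) ≤ s := by positivity
  have hm0 : (0:ℝ) ≤ m := by positivity
  have q1 : (0:ℝ) < (M:ℝ) + 1 - m := by linarith
  have q2 : (0:ℝ) < (M:ℝ) + 1 - s := by linarith
  have F1 : (M.choose m : ℝ) = (M+1).choose m * ((M:ℝ) + 1 - m) / (M+1) := by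
    rw [← E1]; field_simp
  have F2 : ((M-s).choose m : ℝ) = (M+1-s).choose m * ((M:ℝ) + 1 - s - m) / ((M:ℝ) + 1 - s) := by
    rw [← E2]; field_simp
  have hle : ((M + 1 - s).choose m : ℝ) / ((M+1).choose m : ℝ) ≤ 1 := by
    apply div_le_one_of_le₀ _ p2.le
    exact_mod_cast Nat.choose_le_choose m (by omega)
  have hg0 : (0:ℝ) ≤ ((M + 1 - s).choose m : ℝ) / ((M+1).choose m : ℝ) := by positivity
  calc _ = ((M + 1 - s).choose m : ℝ) / ((M+1).choose m : ℝ) *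
        ((s : ℝ) * m / (((M:ℝ) + 1 - s) * ((M:ℝ) + 1 - m))) := by
        rw [F1, F2]; field_simp; ring
    _ ≤ 1 * _ := mul_le_mul_of_nonneg_right hle (by positivity)
    _ = _ := one_mul _

theorem saib_gsteps (M s m w : ℕ) (h : s + m < M) :
    ((M + w - s).choose m : ℝ) / ((M+w).choose m : ℝ) - ((M - s).choose m : ℝ) / (M.choose m : ℝ)
      ≤ w * ((s : ℝ) * m / (((M:ℝ) - s) * ((M:ℝ) - m))) := by
  induction w with
  | zero => simp
  | succ w ih =>
    have h1 := saib_gstep (M + w) s m (by omega)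
    have hM : (s:ℝ) + m < M := by exact_mod_cast h
    have hs0 : (0:ℝ) ≤ s := by positivity
    have hm0 : (0:ℝ) ≤ m := by positivity
    have hw0 : (0:ℝ) ≤ w := by positivity
    have h2 : (s : ℝ) * m / ((((M + w : ℕ):ℝ) + 1 - s) * (((M + w : ℕ):ℝ) + 1 - m)) ≤
       (s : ℝ) * m / (((M:ℝ) - s) * ((M:ℝ) - m)) := by
      push_cast
      have : 0 < (M:ℝ) - s := by linarith
      have : 0 < (M:ℝ) - m := by linarith
      apply div_le_div_of_nonneg_left (by positivity) (by positivity)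
      apply mul_le_mul <;> linarith
    rw [← add_assoc] 
    push_cast
    linarith

theorem saib_gen (n k m : ℕ) (wb : ℝ) (x : Fin n) (V : Finset (Fin n)) (hxV : x ∉ V)
    (hn : 100 ≤ n) (hk1 : 1 ≤ k) (hkn : (k:ℝ) ≤ n / 100) (hmk : m ≤ k)
    (hVn : n ≤ V.card + 2) (hwb : wb ≤ n / 100)
    (q : ℝ) (hq0 : 0 < q) (hq1 : q ≤ 1)
    (hq : 1 - ((V.card - (k-1)).choose m : ℝ) / (V.card.choose m : ℝ) ≤ q)
    (𝒜 : Finset (Finset (Fin n))) (hA : 𝒜 ⊆ kSets n k)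
    (hx : ∀ S ∈ 𝒜, x ∈ S ∧ S.erase x ⊆ V)
    (h8 : ∀ z : Fin n, z ≠ x → vdeg 𝒜 z ≤ 8)
    (hw : ((Finset.univ.filter (fun z : Fin n => z ≠ x ∧ 2 ≤ vdeg 𝒜 z)).card : ℝ) < wb) :
    uprob (V.powersetCard m) (fun B => ∀ S ∈ 𝒜, (B ∩ S.erase x).Nonempty) ≤
      (q + 2 * (k:ℝ)^2 * wb / (n:ℝ)^2) ^ 𝒜.card * Real.exp (2 * (wb * (q^8)⁻¹ * k / n)) := by
  set W0 := Finset.univ.filter (fun z : Fin n => z ≠ x ∧ 2 ≤ vdeg 𝒜 z) with hW0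
  set W := V.filter (fun z => z ∈ W0) with hW
  have hWV : W ⊆ V := Finset.filter_subset _ _
  have hWc : (W.card : ℝ) < wb := by
    refine lt_of_le_of_lt ?_ hw
    norm_cast
    apply Finset.card_le_card
    intro z hz
    exact (Finset.mem_filter.1 hz).2
  have hwb0 : 0 < wb := lt_of_le_of_lt (by positivity) hWc
  have hnR : (100:ℝ) ≤ n := by exact_mod_cast hn
  have hmR : (m:ℝ) ≤ k := by exact_mod_cast hmk
  have hVR : (n:ℝ) ≤ V.card + 2 := by exact_mod_cast hVn
  have hcsd : (V \ W).card = V.card - W.card := Finset.card_sdiff_of_subset hWV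
  have hWVc : W.card ≤ V.card := Finset.card_le_card hWV
  set M := (V \ W).card with hMdef
  have hVM : V.card = M + W.card := by omega
  have hMR : (M:ℝ) = V.card - W.card := by rw [hVM]; push_cast; ring
  have hM97 : (M:ℝ) ≥ 97/100 * n := by rw [hMR]; linarith
  have hk1R : (((k - 1 : ℕ)):ℝ) ≤ k := by exact_mod_cast Nat.sub_le _ _
  have hsm : (k - 1) + m < M := by
    have : (((k-1 : ℕ)):ℝ) + m < M := by linarith
    exact_mod_cast this
  have hmM : m ≤ M := by omega
  set qb := q + 2 * (k:ℝ)^2 * wb / (n:ℝ)^2 with hqb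
  have hqqb : q ≤ qb := by
    rw [hqb]; have : 0 ≤ 2 * (k:ℝ)^2 * wb / (n:ℝ)^2 := by positivity
    linarith
  set r := min qb 1 with hr
  have hqr : q ≤ r := le_min hqqb hq1
  have hr0 : 0 < r := lt_of_lt_of_le hq0 hqr
  have hg := saib_gsteps M (k-1) m W.card hsm
  rw [← hVM] at hg
  have hbd : (W.card : ℝ) * ((((k-1 : ℕ)) : ℝ) * m / (((M:ℝ) - ((k-1:ℕ):ℝ)) * ((M:ℝ) - m)))
      ≤ 2 * (k:ℝ)^2 * wb / (n:ℝ)^2 := by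
    have a1 : 96/100 * (n:ℝ) ≤ (M:ℝ) - ((k-1:ℕ):ℝ) := by linarith
    have a2 : 96/100 * (n:ℝ) ≤ (M:ℝ) - m := by linarith
    have a3 : (n:ℝ)^2 / 2 ≤ ((M:ℝ) - ((k-1:ℕ):ℝ)) * ((M:ℝ) - m) := by
      calc (n:ℝ)^2/2 ≤ (96/100 * (n:ℝ)) * (96/100 * (n:ℝ)) := by nlinarith
        _ ≤ _ := mul_le_mul a1 a2 (by positivity) (by linarith)
    calc _ ≤ wb * ((k:ℝ) * k / ((n:ℝ)^2/2)) := by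
          apply mul_le_mul hWc.le _ _ hwb0.le
          · apply div_le_div₀ (by positivity) _ (by positivity) a3
            exact mul_le_mul hk1R hmR (by positivity) (by positivity)
          · apply div_nonneg (by positivity)
            exact le_trans (by positivity) a3
      _ = _ := by field_simp
  have hmain := saib_main V W hWV m hmM 𝒜 (fun S => S.erase x) (fun S hS => (hx S hS).2)
    (by
      intro S hS S' hS' hne
      rw [Finset.disjoint_left]
      intro v hv hv'
      simp only [Finset.mem_sdiff, Finset.mem_erase] at hv hv'
      apply hv.2
      rw [hW, Finset.mem_filter, hW0, Finset.mem_filter]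
      refine ⟨(hx S hS).2 (Finset.mem_erase.2 hv.1), Finset.mem_univ _, hv.1.1, ?_⟩
      unfold vdeg starOf
      have : ({S, S'} : Finset (Finset (Fin n))) ⊆ 𝒜.filter (fun A => v ∈ A) := by
        intro A hA'
        simp only [Finset.mem_insert, Finset.mem_singleton] at hA'
        rcases hA' with rfl | rfl
        · exact Finset.mem_filter.2 ⟨hS, hv.1.2⟩
        · exact Finset.mem_filter.2 ⟨hS', hv'.1.2⟩
      have h2 := Finset.card_le_card this
      rwa [Finset.card_pair hne] at h2)
    (by
      intro v hv
      have hvx : v ≠ x := by rintro rfl; exact hxV (hWV hv)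
      refine le_trans (Finset.card_le_card ?_) (h8 v hvx)
      intro S hS
      rw [Finset.mem_filter] at hS
      unfold starOf
      exact Finset.mem_filter.2 ⟨hS.1, Finset.mem_of_mem_erase hS.2⟩)
    r hr0 (min_le_right _ _)
    (by
      intro S hS
      apply le_min _ (saib_uprob_le_one _ _)
      have hScard : S.card = k := by
        have := hA hS
        simp only [kSets, Finset.mem_powersetCard] at this
        exact this.2
      have hc1 : (S.erase x \ W).card ≤ k - 1 := by
        refine (Finset.card_le_card Finset.sdiff_subset).trans ?_
        rw [Finset.card_erase_of_mem (hx S hS).1, hScard]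
      rw [saib_hit (V \ W) (S.erase x \ W) (Finset.sdiff_subset_sdiff (hx S hS).2 le_rfl) m hmM]
      rw [← hMdef]
      have h3 : ((M - (k-1)).choose m : ℝ) / (M.choose m : ℝ) ≤
          ((M - (S.erase x \ W).card).choose m : ℝ) / (M.choose m : ℝ) := by
        apply div_le_div_of_nonneg_right _ (by positivity)
        exact_mod_cast Nat.choose_le_choose m (by omega)
      linarith)
  refine hmain.trans ?_
  have hrq : r ≤ qb := min_le_left _ _
  have b0 : 0 ≤ (r^8)⁻¹ * ((m:ℝ) / V.card) := mul_nonneg (inv_nonneg.2 (pow_nonneg hr0.le 8))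
    (div_nonneg (Nat.cast_nonneg _) (Nat.cast_nonneg _))
  apply mul_le_mul (pow_le_pow_left₀ hr0.le hrq _) _ (pow_nonneg (by linarith) _)
    (pow_nonneg (hr0.le.trans hrq) _)
  have hVpos : (0:ℝ) < V.card := by linarith
  have hV2 : (n:ℝ) / 2 ≤ V.card := by linarith
  have hnpos : (0:ℝ) < n := by linarith
  have b1 : (r^8)⁻¹ ≤ (q^8)⁻¹ := inv_anti₀ (by positivity) (pow_le_pow_left₀ hq0.le hqr 8)
  have b2 : (m:ℝ) / V.card ≤ 2 * k / n := by
    rw [div_le_div_iff₀ hVpos hnpos]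
    nlinarith
  have b3 : (r^8)⁻¹ * ((m:ℝ) / V.card) ≤ (q^8)⁻¹ * (2 * k / n) :=
    mul_le_mul b1 b2 (div_nonneg (Nat.cast_nonneg _) (Nat.cast_nonneg _)) (by positivity)
  calc (1 + (r^8)⁻¹ * ((m:ℝ) / V.card)) ^ W.card
      ≤ (Real.exp ((r^8)⁻¹ * ((m:ℝ) / V.card))) ^ W.card := by
        apply pow_le_pow_left₀ (by linarith)
        rw [add_comm]; exact Real.add_one_le_exp _
    _ = Real.exp (W.card * ((r^8)⁻¹ * ((m:ℝ) / V.card))) := by rw [Real.exp_nat_mul]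
    _ ≤ _ := by
        apply Real.exp_le_exp.2
        calc _ ≤ wb * ((q^8)⁻¹ * (2 * k / n)) :=
              mul_le_mul hWc.le b3 b0 hwb0.le
          _ = _ := by ring

theorem saib_partA (n k : ℕ) (wb : ℝ) (x : Fin n) 
    (hn : 100 ≤ n) (hk1 : 1 ≤ k) (hkn : (k:ℝ) ≤ n / 100) (hwb : wb ≤ n / 100)
    (hq0 : 0 < interProb n k)
    (𝒜 : Finset (Finset (Fin n))) (hA : 𝒜 ⊆ kSets n k)
    (hx : ∀ S ∈ 𝒜, x ∈ S)
    (h8 : ∀ z : Fin n, z ≠ x → vdeg 𝒜 z ≤ 8)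
    (hw : ((Finset.univ.filter (fun z : Fin n => z ≠ x ∧ 2 ≤ vdeg 𝒜 z)).card : ℝ) < wb) :
    uprob ((kSets n k).filter fun B => x ∉ B) (fun B => ∀ S ∈ 𝒜, (B ∩ S).Nonempty) ≤
      (interProb n k + 2 * (k:ℝ)^2 * wb / (n:ℝ)^2) ^ 𝒜.card *
        Real.exp (2 * (wb * ((interProb n k)^8)⁻¹ * k / n)) := by
  have hkn' : k * 100 ≤ n := by
    have : (k:ℝ) * 100 ≤ n := by linarith
    exact_mod_cast this
  have hI := saib_interProb n k (by omega)
  have hVc : (Finset.univ.erase x).card = n - 1 := by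
    rw [Finset.card_erase_of_mem (Finset.mem_univ _), Finset.card_univ, Fintype.card_fin]
  have hset : ((kSets n k).filter fun B => x ∉ B) = (Finset.univ.erase x).powersetCard k := by
    ext B
    simp only [kSets, Finset.mem_filter, Finset.mem_powersetCard, Finset.subset_univ, true_and,
      Finset.subset_erase]
    tauto
  rw [hset]
  refine le_trans (saib_uprob_mono _ _ (fun B => ∀ S ∈ 𝒜, (B ∩ S.erase x).Nonempty) ?_)
    (saib_gen n k k wb x (Finset.univ.erase x) (by simp) hn hk1 hkn le_rfl (by omega) hwb
      (interProb n k) hq0 ?_ ?_ 𝒜 hA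
      (fun S hS => ⟨hx S hS, Finset.erase_subset_erase _ (Finset.subset_univ _)⟩) h8 hw)
  · intro B hB h S hS
    rw [Finset.mem_powersetCard, Finset.subset_erase] at hB
    obtain ⟨v, hv⟩ := h S hS
    rw [Finset.mem_inter] at hv
    refine ⟨v, Finset.mem_inter.2 ⟨hv.1, Finset.mem_erase.2 ⟨?_, hv.2⟩⟩⟩
    rintro rfl; exact hB.1.2 hv.1
  · rw [hI]
    have : 0 ≤ ((n - k).choose k : ℝ) / (n.choose k : ℝ) := by positivity
    linarith
  · rw [hI, hVc, show n - 1 - (k - 1) = n - k by omega]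
    have p1 : (0:ℝ) < (n-1).choose k := by exact_mod_cast Nat.choose_pos (by omega)
    have : ((n - k).choose k : ℝ) / (n.choose k : ℝ) ≤ ((n - k).choose k : ℝ) / ((n-1).choose k : ℝ) := by
      apply div_le_div_of_nonneg_left (by positivity) p1
      exact_mod_cast Nat.choose_le_choose k (by omega)
    linarith

theorem saib_uprob_image {α β : Type*} [DecidableEq β] (t : Finset α) (f : α → β)
    (hf : Set.InjOn f t) (E : β → Prop) :
    uprob (t.image f) E = uprob t (fun a => E (f a)) := by
  rw [saib_uprob_eq, saib_uprob_eq, Finset.card_image_of_injOn hf, saib_cnt_eq, saib_cnt_eq,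
    Finset.filter_image, Finset.card_image_of_injOn]
  intro a ha b hb h
  exact hf (Finset.mem_filter.1 ha).1 (Finset.mem_filter.1 hb).1 h

theorem saib_partB (n k : ℕ) (wb : ℝ) (x y : Fin n) (hxy : x ≠ y)
    (hn : 100 ≤ n) (hk1 : 1 ≤ k) (hkn : (k:ℝ) ≤ n / 100) (hwb : wb ≤ n / 100)
    (hq0 : 0 < interProb n k)
    (𝒜 : Finset (Finset (Fin n))) (hA : 𝒜 ⊆ kSets n k)
    (hx : ∀ S ∈ 𝒜, x ∈ S ∧ y ∉ S)
    (h8 : ∀ z : Fin n, z ≠ x → vdeg 𝒜 z ≤ 8)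
    (hw : ((Finset.univ.filter (fun z : Fin n => z ≠ x ∧ 2 ≤ vdeg 𝒜 z)).card : ℝ) < wb) :
    uprob ((kSets n k).filter fun B => y ∈ B ∧ x ∉ B) (fun B => ∀ S ∈ 𝒜, (B ∩ S).Nonempty) ≤
      (interProb n k + 2 * (k:ℝ)^2 * wb / (n:ℝ)^2) ^ 𝒜.card *
        Real.exp (2 * (wb * ((interProb n k)^8)⁻¹ * k / n)) := by
  have hkn' : k * 100 ≤ n := by
    have : (k:ℝ) * 100 ≤ n := by linarith
    exact_mod_cast this
  have hI := saib_interProb n k (by omega)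
  have hVc : ((Finset.univ.erase x).erase y).card = n - 2 := by
    rw [Finset.card_erase_of_mem (by simp [hxy.symm]),
      Finset.card_erase_of_mem (Finset.mem_univ _), Finset.card_univ, Fintype.card_fin]
    omega
  have hset : ((kSets n k).filter fun B => y ∈ B ∧ x ∉ B) =
      (((Finset.univ.erase x).erase y).powersetCard (k-1)).image (fun B => insert y B) := by
    ext B
    simp only [kSets, Finset.mem_filter, Finset.mem_powersetCard, Finset.subset_univ, true_and,
      Finset.subset_erase, Finset.mem_image]
    constructor
    · rintro ⟨h1, h2, h3⟩
      refine ⟨B.erase y, ⟨⟨fun h => h3 (Finset.mem_of_mem_erase h), by simp⟩, ?_⟩, ?_⟩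
      · rw [Finset.card_erase_of_mem h2, h1]
      · exact Finset.insert_erase h2
    · rintro ⟨C, ⟨⟨h1, h2⟩, h3⟩, rfl⟩
      refine ⟨?_, by simp, ?_⟩
      · rw [Finset.card_insert_of_notMem h2, h3]; omega
      · simp [hxy, h1]
  rw [hset, saib_uprob_image]
  swap
  · intro B hB C hC h
    simp only [Finset.mem_coe, Finset.mem_powersetCard, Finset.subset_erase] at hB hC
    have := congrArg (fun T => Finset.erase T y) h
    simpa [Finset.erase_insert, hB.1.2, hC.1.2] using this
  refine le_trans (saib_uprob_mono _ _ (fun B => ∀ S ∈ 𝒜, (B ∩ S.erase x).Nonempty) ?_)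
    (saib_gen n k (k-1) wb x ((Finset.univ.erase x).erase y) (by simp) hn hk1 hkn (by omega)
      (by omega) hwb
      (interProb n k) hq0 ?_ ?_ 𝒜 hA
      (fun S hS => ⟨(hx S hS).1, ?_⟩) h8 hw)
  · intro B hB h S hS
    simp only [Finset.mem_powersetCard, Finset.subset_erase] at hB
    obtain ⟨v, hv⟩ := h S hS
    rw [Finset.mem_inter, Finset.mem_insert] at hv
    have hvB : v ∈ B := by
      rcases hv.1 with rfl | h
      · exact absurd hv.2 (hx S hS).2
      · exact h
    refine ⟨v, Finset.mem_inter.2 ⟨hvB, Finset.mem_erase.2 ⟨?_, hv.2⟩⟩⟩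
    rintro rfl; exact hB.1.1.2 hvB
  · rw [hI]
    have : 0 ≤ ((n - k).choose k : ℝ) / (n.choose k : ℝ) := by positivity
    linarith
  · rw [hI, hVc]
    obtain ⟨j, rfl⟩ : ∃ j, k = j + 1 := ⟨k - 1, by omega⟩
    obtain ⟨t, rfl⟩ : ∃ t, n = t + 2 := ⟨n - 2, by omega⟩
    simp only [Nat.add_sub_cancel]
    have p1 : (0:ℝ) < t.choose j := by exact_mod_cast Nat.choose_pos (by omega)
    have p2 : (0:ℝ) < (t+2).choose (j+1) := by exact_mod_cast Nat.choose_pos (by omega)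
    have e1 := Nat.add_one_mul_choose_eq (t - j) j
    have e2 := Nat.add_one_mul_choose_eq (t + 1) j
    have e3 := Nat.choose_mul_succ_eq t j
    have hs : t + 2 - (j + 1) = t - j + 1 := by omega
    have hs' : t + 1 - j = t - j + 1 := by omega
    rw [hs]
    rw [hs'] at e3
    have key : ((t - j + 1).choose (j+1) : ℝ) / ((t+2).choose (j+1) : ℝ)
        ≤ ((t-j).choose j : ℝ) / (t.choose j : ℝ) := by
      rw [div_le_div_iff₀ p2 p1]
      norm_cast
      apply Nat.le_of_mul_le_mul_right (c := (j+1) * (t - j + 1)) _ (by positivity)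
      calc (t - j + 1).choose (j+1) * t.choose j * ((j+1) * (t-j+1))
          = ((t - j + 1).choose (j+1) * (j+1)) * (t.choose j * (t - j + 1)) := by ring
        _ = ((t-j).choose j * t.choose j) * ((t - j + 1) * (t - j + 1)) := by rw [← e1]; ring
        _ ≤ ((t-j).choose j * t.choose j) * ((t + 2) * (t + 1)) := by
            apply Nat.mul_le_mul_left
            apply Nat.mul_le_mul <;> omega
        _ = (t-j).choose j * (t + 2) * (t.choose j * (t + 1)) := by ring
        _ = (t-j).choose j * ((t + 1 + 1) * (t+1).choose j) * (t - j + 1) := by rw [e3]; ring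
        _ = _ := by rw [e2]; ring
    linarith
  · intro v hv
    rw [Finset.mem_erase] at hv
    simp only [Finset.mem_erase, Finset.mem_univ, and_true]
    refine ⟨?_, hv.1⟩
    rintro rfl; exact (hx S hS).2 hv.2

theorem saib_ratio_up (N s m : ℕ) :
    (N - s).choose m * N ^ m ≤ N.choose m * (N - s) ^ m := by
  induction m with
  | zero => simp
  | succ m ih =>
    have e1 := Nat.choose_succ_right_eq (N - s) m
    have e2 := Nat.choose_succ_right_eq N m
    apply Nat.le_of_mul_le_mul_right (c := m + 1) _ (by omega)
    have h3 : (N - s - m) * N ≤ (N - m) * (N - s) := by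
      rcases le_or_gt (s + m) N with h | h
      · obtain ⟨t, rfl⟩ : ∃ t, N = s + m + t := ⟨N - (s+m), by omega⟩
        rw [show s + m + t - s - m = t by omega, show s + m + t - m = s + t by omega,
          show s + m + t - s = m + t by omega]
        nlinarith [Nat.zero_le (s*m)]
      · rw [show N - s - m = 0 by omega]; simp
    calc (N - s).choose (m+1) * N ^ (m+1) * (m+1)
        = ((N - s).choose (m+1) * (m+1)) * N ^ (m+1) := by ring
      _ = ((N - s).choose m * N ^ m) * ((N - s - m) * N) := by rw [e1]; ring
      _ ≤ (N.choose m * (N - s) ^ m) * ((N - m) * (N - s)) := Nat.mul_le_mul ih h3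
      _ = (N.choose m * (N - m)) * (N - s) ^ (m+1) := by ring
      _ = _ := by rw [← e2]; ring

theorem saib_ratio_low (N s m i : ℕ) (h : s + m ≤ N) (hi : i ≤ m) :
    N.choose i * (N - s - m) ^ i ≤ (N - s).choose i * (N - m) ^ i := by
  induction i with
  | zero => simp
  | succ i ih =>
    have ih := ih (by omega)
    have e1 := Nat.choose_succ_right_eq (N - s) i
    have e2 := Nat.choose_succ_right_eq N i
    apply Nat.le_of_mul_le_mul_right (c := i + 1) _ (by omega)
    have h3 : (N - i) * (N - s - m) ≤ (N - s - i) * (N - m) := by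
      obtain ⟨t, rfl⟩ : ∃ t, N = s + m + t := ⟨N - (s+m), by omega⟩
      obtain ⟨j, rfl⟩ : ∃ j, m = i + j := ⟨m - i, by omega⟩
      rw [show s + (i + j) + t - s - (i + j) = t by omega,
        show s + (i + j) + t - (i + j) = s + t by omega,
        show s + (i + j) + t - s - i = j + t by omega,
        show s + (i + j) + t - i = s + j + t by omega]
      nlinarith [Nat.zero_le (s*j)]
    calc N.choose (i+1) * (N - s - m) ^ (i+1) * (i+1)
        = (N.choose (i+1) * (i+1)) * (N - s - m) ^ (i+1) := by ring
      _ = (N.choose i * (N - s - m) ^ i) * ((N - i) * (N - s - m)) := by rw [e2]; ring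
      _ ≤ ((N - s).choose i * (N - m) ^ i) * ((N - s - i) * (N - m)) := Nat.mul_le_mul ih h3
      _ = ((N - s).choose i * (N - s - i)) * (N - m) ^ (i+1) := by ring
      _ = _ := by rw [← e1]; ring

theorem saib_miss_up (n k : ℕ) (hk : k ≤ n) (hn : 0 < n) :
    ((n - k).choose k : ℝ) / (n.choose k : ℝ) ≤ Real.exp (-((k:ℝ)^2 / n)) := by
  have hcp : (0:ℝ) < n.choose k := by exact_mod_cast Nat.choose_pos hk
  have hnR : (0:ℝ) < n := by exact_mod_cast hn
  have h : ((n - k).choose k : ℝ) * (n:ℝ) ^ k ≤ n.choose k * ((n:ℝ) - k) ^ k := by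
    rw [← Nat.cast_sub hk]; exact_mod_cast saib_ratio_up n k k
  have hkR : (k:ℝ) ≤ n := by exact_mod_cast hk
  calc _ ≤ (((n:ℝ) - k) / n) ^ k := by
        rw [div_pow, div_le_div_iff₀ hcp (by positivity)]; linarith
    _ ≤ (Real.exp (-((k:ℝ) / n))) ^ k := by
        apply pow_le_pow_left₀ (div_nonneg (by linarith) hnR.le)
        have := Real.add_one_le_exp (-((k:ℝ)/n))
        have e : ((n:ℝ) - k) / n = -((k:ℝ)/n) + 1 := by field_simp; ring
        rw [e]; exact this
    _ = _ := by rw [← Real.exp_nat_mul]; congr 1; ring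

theorem saib_miss_low (n k : ℕ) (hk : 2 * k < n) :
    Real.exp (-((k:ℝ)^2 / (n - 2 * k))) ≤ ((n - k).choose k : ℝ) / (n.choose k : ℝ) := by
  have hcp : (0:ℝ) < n.choose k := by exact_mod_cast Nat.choose_pos (by omega)
  have hkR : 2 * (k:ℝ) < n := by exact_mod_cast hk
  have hk0 : (0:ℝ) ≤ k := by positivity
  have a1 : (0:ℝ) < n - 2 * k := by linarith
  have a2 : (0:ℝ) < n - k := by linarith
  have h : (n.choose k : ℝ) * ((n:ℝ) - 2 * k) ^ k ≤ (n-k).choose k * ((n:ℝ) - k) ^ k := by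
    have h0 := saib_ratio_low n k k k (by omega) le_rfl
    have c1 : ((n - k : ℕ):ℝ) = (n:ℝ) - k := Nat.cast_sub (by omega)
    have c2 : ((n - k - k : ℕ):ℝ) = (n:ℝ) - 2 * k := by
      rw [Nat.cast_sub (by omega), c1]; ring
    rw [← c1, ← c2]; exact_mod_cast h0
  have h1 : (((n:ℝ) - k) / (n - 2*k)) ^ k ≤ Real.exp ((k:ℝ)^2 / (n - 2 * k)) := by
    calc _ ≤ (Real.exp ((k:ℝ) / (n - 2*k))) ^ k := by
          apply pow_le_pow_left₀ (by positivity)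
          have := Real.add_one_le_exp ((k:ℝ)/(n - 2*k))
          have e : ((n:ℝ) - k) / (n - 2*k) = ((k:ℝ)/(n - 2 *k)) + 1 := by
            rw [div_add_one a1.ne']; congr 1; ring
          rw [e]; exact this
      _ = _ := by rw [← Real.exp_nat_mul]; congr 1; ring
  calc _ ≤ (((n:ℝ) - 2 * k) / (n - k)) ^ k := by
        rw [Real.exp_neg]
        apply inv_le_of_inv_le₀ (by positivity)
        rw [← inv_pow, inv_div]; exact h1
    _ ≤ _ := by rw [div_pow, div_le_div_iff₀ (by positivity) hcp]; linarith

set_option maxHeartbeats 2000000 in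
theorem saib_asym (n k : ℕ) (p ε : ℝ) (hε0 : 0 < ε) (hε14 : ε < 1/4) (hp : 0 ≤ p)
    (hk2 : 2 * k < n) (hL : 2 ≤ Real.log n)
    (hlow : Real.exp ((1/2 - ε/64) * Real.log n) < k)
    (hup : (k:ℝ) < Real.sqrt ((1 / 4 - ε) * n * Real.log n))
    (hkε : (k:ℝ) ≤ ε * n)
    (hφ : phi n k p ≤ phiStar n k) :
    0 < interProb n k ∧ interProb n k ≤ 1 ∧
    wbar n k p * ((interProb n k)^8)⁻¹ * k / n ≤
      256 * ((Real.log n)^8 * Real.exp (-(3/4 * ε * Real.log n))) := by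
  have hn0 : 0 < n := by omega
  have hnR : (0:ℝ) < n := by exact_mod_cast hn0
  have hI := saib_interProb n k (by omega)
  have hmu := saib_miss_up n k (by omega) hn0
  have hml := saib_miss_low n k hk2
  set L := Real.log n with hLdef
  set q := interProb n k with hqdef
  have hnL : (n:ℝ) = Real.exp L := (Real.exp_log hnR).symm
  have hkp : (0:ℝ) < k := lt_trans (Real.exp_pos _) hlow
  have hkR : 2 * (k:ℝ) < n := by exact_mod_cast hk2
  -- bounds on k^2
  have hksq : (k:ℝ)^2 < (1/4 - ε) * n * L := by
    have hnn : 0 ≤ (1/4 - ε) * n * L :=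
      mul_nonneg (mul_nonneg (by linarith) hnR.le) (by linarith)
    have := (Real.lt_sqrt hkp.le).1 hup
    exact this
  have hq1 : q ≤ 1 := by
    rw [hI]
    have : 0 ≤ ((n - k).choose k : ℝ) / (n.choose k : ℝ) := by positivity
    linarith
  -- lower bound on q
  have hx : Real.exp (-(ε/32 * L)) ≤ (k:ℝ)^2 / n := by
    rw [le_div_iff₀ hnR, hnL, ← Real.exp_add]
    calc Real.exp (-(ε/32*L) + L) = (Real.exp ((1/2 - ε/64) * L))^2 := by
          rw [← Real.exp_nat_mul]; congr 1; push_cast; ring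
      _ ≤ (k:ℝ)^2 := pow_le_pow_left₀ (Real.exp_pos _).le hlow.le 2
  have hqlow : Real.exp (-(ε/32 * L)) / 2 ≤ q := by
    set y := Real.exp (-(ε/32 * L)) with hy
    have hy0 : 0 < y := Real.exp_pos _
    have hy1 : y ≤ 1 := Real.exp_le_one_iff.2 (by
      have : 0 ≤ ε/32 * L := by positivity
      linarith)
    have h1 : Real.exp (-((k:ℝ)^2/n)) ≤ Real.exp (-y) := Real.exp_le_exp.2 (by linarith)
    have h2 : Real.exp (-y) ≤ 1 / (1 + y) := by
      rw [Real.exp_neg, one_div]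
      apply inv_anti₀ (by linarith)
      have := Real.add_one_le_exp y
      linarith
    have h3 : 1 / (1+y) ≤ 1 - y/2 := by
      rw [div_le_iff₀ (by linarith)]; nlinarith
    rw [hI]; linarith
  have hq0 : 0 < q := lt_of_lt_of_le (by positivity) hqlow
  refine ⟨hq0, hq1, ?_⟩
  have hqinv : (q^8)⁻¹ ≤ 256 * Real.exp (ε/4 * L) := by
    have h1 : (Real.exp (-(ε/32 * L)) / 2)^8 ≤ q^8 := pow_le_pow_left₀ (by positivity) hqlow 8
    have h2 : ((Real.exp (-(ε/32 * L)) / 2)^8)⁻¹ = 256 * Real.exp (ε/4 * L) := by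
      rw [div_pow, ← Real.exp_nat_mul, inv_div, div_eq_mul_inv, ← Real.exp_neg]
      norm_num
      ring
    rw [← h2]
    exact inv_anti₀ (by positivity) h1
  -- upper bound on phi
  have h1q : Real.exp (-((1/4 - ε/2) * L)) ≤ 1 - q := by
    have : (k:ℝ)^2 / (n - 2*k) ≤ (1/4 - ε/2) * L := by
      rw [div_le_iff₀ (by linarith)]
      have h1 : (1/4 - ε) * n ≤ (1/4 - ε/2) * (n - 2*k) := by nlinarith
      have h2 : (1/4 - ε) * n * L ≤ (1/4 - ε/2) * (n - 2*k) * L :=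
        mul_le_mul_of_nonneg_right h1 (by linarith)
      linarith
    have h2 : Real.exp (-((1/4 - ε/2) * L)) ≤ Real.exp (-((k:ℝ)^2 / (n - 2 * k))) :=
      Real.exp_le_exp.2 (by linarith)
    rw [hI]; linarith
  have hlogq : Real.exp (-((1/4 - ε/2) * L)) ≤ Real.log (1/q) := by
    rw [one_div q, Real.log_inv]
    have := Real.log_le_sub_one_of_pos hq0
    linarith
  have hφ0 : 0 ≤ phi n k p := by unfold phi; positivity
  have hφ1 : phi n k p ≤ L^3 * Real.exp ((1/4 - ε/2) * L) := by
    refine hφ.trans ?_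
    unfold phiStar
    rw [← hqdef, ← hLdef]
    rw [div_le_iff₀ (lt_of_lt_of_le (Real.exp_pos _) hlogq)]
    have hL3 : 0 ≤ L^3 := by positivity
    calc L^3 = L^3 * Real.exp ((1/4 - ε/2) * L) * Real.exp (-((1/4 - ε/2) * L)) := by
          rw [mul_assoc, ← Real.exp_add]; simp
      _ ≤ _ := mul_le_mul_of_nonneg_left hlogq (by positivity)
  have hkn : (k:ℝ)^2 / n ≤ L := by
    rw [div_le_iff₀ hnR]
    have : 0 ≤ n * L := by positivity
    nlinarith
  have hw : wbar n k p ≤ L^7 * Real.exp ((1/2 - ε) * L) := by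
    unfold wbar
    rw [← hLdef]
    apply max_le
    · calc phi n k p ^ 2 * (k:ℝ)^2 / n = phi n k p ^ 2 * ((k:ℝ)^2 / n) := by ring
        _ ≤ (L^3 * Real.exp ((1/4 - ε/2) * L))^2 * L :=
            mul_le_mul (pow_le_pow_left₀ hφ0 hφ1 2) hkn (by positivity) (by positivity)
        _ = L^7 * (Real.exp ((1/4 - ε/2) * L))^2 := by ring
        _ = _ := by rw [← Real.exp_nat_mul]; congr 2; push_cast; ring
    · have h1 : 1 ≤ Real.exp ((1/2 - ε) * L) := Real.one_le_exp (by
        apply mul_nonneg <;> linarith)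
      have h2 : (2:ℝ)^6 ≤ L^6 := pow_le_pow_left₀ (by norm_num) hL 6
      calc 6 * L ≤ L^6 * L := by nlinarith
        _ = L^7 * 1 := by ring
        _ ≤ _ := mul_le_mul_of_nonneg_left h1 (by positivity)
  have hw0 : 0 ≤ wbar n k p := le_trans (by linarith : 0 ≤ 6 * L) (le_max_right _ _)
  have hkn2 : (k:ℝ) / n ≤ L * Real.exp (-(L/2)) := by
    rw [div_le_iff₀ hnR]
    have h1 : L * Real.exp (-(L/2)) * n = L * Real.exp (L/2) := by
      rw [hnL, mul_assoc, ← Real.exp_add]; congr 2; ring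
    rw [h1]
    apply le_of_sq_le_sq _ (by positivity)
    rw [mul_pow, ← Real.exp_nat_mul]
    have h2 : ((2:ℕ):ℝ) * (L/2) = L := by push_cast; ring
    rw [h2, ← hnL]
    have : (k:ℝ)^2 ≤ L * n := by rwa [div_le_iff₀ hnR] at hkn
    have h3 : L * n ≤ L^2 * n := by
      apply mul_le_mul_of_nonneg_right _ hnR.le
      nlinarith
    linarith
  calc wbar n k p * (q^8)⁻¹ * k / n = wbar n k p * (q^8)⁻¹ * (k / n) := by ring
    _ ≤ (L^7 * Real.exp ((1/2 - ε) * L)) * (256 * Real.exp (ε/4 * L)) * (L * Real.exp (-(L/2))) := by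
        apply mul_le_mul (mul_le_mul hw hqinv (by positivity) (by positivity)) hkn2
          (by positivity) (by positivity)
    _ = 256 * (L^8 * (Real.exp ((1/2 - ε) * L) * Real.exp (ε/4 * L) * Real.exp (-(L/2)))) := by ring
    _ = _ := by rw [← Real.exp_add, ← Real.exp_add]; congr 3; ring

end SAIB

/-- **Proposition (a)&(b).** Under the standing assumptions, with `w̄ = max{φ²k²/n, 6 log n}`
and `q̄ = (1 + 2k²w̄/(q n²)) q`: (a) if all members of `𝒜 = {A_1,…,A_d}` are `k`-sets
containing `x`, every `z ≠ x` lies in at most `8` members of `𝒜`, and fewer than `w̄`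
vertices `z ≠ x` lie in at least `2` members, then for `B` uniform among `k`-sets not
containing `x`, `Pr(B ∩ A_i ≠ ∅ ∀i) < (1+o(1)) q̄^d`; (b) the same if the members of `𝒜`
contain `x` but avoid `y`, and `B` is uniform among `k`-sets containing `y` but not `x`.
The `o(1)` is uniform over all admissible choices. -/
theorem star_avoiding_intersection_bound
    (ε : ℝ) (hε0 : 0 < ε) (hε14 : ε < 1 / 4)
    (k : ℕ → ℕ) (p : ℕ → ℝ)
    (hp0 : ∀ n, 0 ≤ p n) (hp1 : ∀ n, p n ≤ 1)
    (hnk : ∀ᶠ n in atTop, 2 * k n < n)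
    (δ : ℕ → ℝ) (hδ : Tendsto δ atTop (nhds 0))
    (hklow : ∀ᶠ n : ℕ in atTop, (n : ℝ) ^ ((1 : ℝ) / 2 - δ n) < (k n : ℝ))
    (hkup : ∀ᶠ n in atTop, (k n : ℝ) < Real.sqrt ((1 / 4 - ε) * n * Real.log n))
    (σ υ : ℕ → ℝ) (hσ : Tendsto σ atTop (nhds 0)) (hυ : Tendsto υ atTop (nhds 0))
    (hLam : ∀ᶠ n in atTop,
      hprob n (k n) (p n) (fun H => σ n < Lam n (k n) (p n) (maxDegree H)) < υ n)
    (hφ : ∀ᶠ n in atTop, phi n (k n) (p n) ≤ phiStar n (k n))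
    :
    ∃ err : ℕ → ℝ, Tendsto err atTop (nhds 0) ∧
      ∀ᶠ n in atTop,
        (∀ x : Fin n, ∀ 𝒜 : Finset (Finset (Fin n)), 𝒜 ⊆ kSets n (k n) →
          (∀ S ∈ 𝒜, x ∈ S) →
          (∀ z : Fin n, z ≠ x → vdeg 𝒜 z ≤ 8) →
          ((Finset.univ.filter (fun z : Fin n => z ≠ x ∧ 2 ≤ vdeg 𝒜 z)).card : ℝ) <
              wbar n (k n) (p n) →
          uprob ((kSets n (k n)).filter fun B => x ∉ B)
              (fun B => ∀ S ∈ 𝒜, (B ∩ S).Nonempty) <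
            (1 + err n) * qbar n (k n) (p n) ^ 𝒜.card) ∧
        (∀ x y : Fin n, x ≠ y → ∀ 𝒜 : Finset (Finset (Fin n)), 𝒜 ⊆ kSets n (k n) →
          (∀ S ∈ 𝒜, x ∈ S ∧ y ∉ S) →
          (∀ z : Fin n, z ≠ x → vdeg 𝒜 z ≤ 8) →
          ((Finset.univ.filter (fun z : Fin n => z ≠ x ∧ 2 ≤ vdeg 𝒜 z)).card : ℝ) <
              wbar n (k n) (p n) →
          uprob ((kSets n (k n)).filter fun B => y ∈ B ∧ x ∉ B)
              (fun B => ∀ S ∈ 𝒜, (B ∩ S).Nonempty) <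
            (1 + err n) * qbar n (k n) (p n) ^ 𝒜.card) := by
  set F : ℕ → ℝ := fun n => 256 * ((Real.log n)^8 * Real.exp (-(3/4 * ε * Real.log n))) with hF
  have hlog : Tendsto (fun n : ℕ => Real.log n) atTop atTop :=
    Real.tendsto_log_atTop.comp tendsto_natCast_atTop_atTop
  have hFt : Tendsto F atTop (nhds 0) := by
    have hlin : Tendsto (fun n : ℕ => 3/4 * ε * Real.log n) atTop atTop :=
      hlog.const_mul_atTop (by positivity)
    have h1 := (Real.tendsto_pow_mul_exp_neg_atTop_nhds_zero 8).comp hlin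
    have h2 := h1.const_mul (256 * ((3/4 * ε)^8)⁻¹)
    rw [mul_zero] at h2
    refine h2.congr (fun n => ?_)
    simp only [hF, Function.comp]
    rw [mul_pow]
    field_simp
  refine ⟨fun n => Real.exp (2 * F n) - 1 + 1 / ((n:ℝ) + 1), ?_, ?_⟩
  · have h1 : Tendsto (fun n => Real.exp (2 * F n)) atTop (nhds 1) := by
      have := (Real.continuous_exp.tendsto 0).comp (by simpa using hFt.const_mul 2)
      simpa [Function.comp_def] using this
    have h2 := (h1.sub_const 1).add (tendsto_one_div_add_atTop_nhds_zero_nat (𝕜 := ℝ))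
    simpa using h2
  have hδe : ∀ᶠ n in atTop, δ n < ε / 64 := hδ.eventually_lt_const (by positivity)
  have hF1 : ∀ᶠ n in atTop, F n < 1/100 := hFt.eventually_lt_const (by norm_num)
  have hkl : Tendsto (fun n : ℕ => Real.log n / n) atTop (nhds 0) := by
    have h := (Real.isLittleO_log_id_atTop.tendsto_div_nhds_zero).comp
      (tendsto_natCast_atTop_atTop (R := ℝ))
    exact h
  have hmin : 0 < (min ε (1/100))^2 := by positivity
  have hkl' := hkl.eventually_lt_const hmin
  filter_upwards [hnk, hklow, hkup, hφ, hδe, hF1, hkl', hlog.eventually_ge_atTop 2,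
    eventually_ge_atTop 100] with n hnk hklow hkup hφ hδe hF1 hkl hL hn
  have hnR : (100:ℝ) ≤ n := by exact_mod_cast hn
  have hnp : (0:ℝ) < n := by linarith
  have hlow : Real.exp ((1/2 - ε/64) * Real.log n) < k n := by
    refine lt_of_le_of_lt ?_ hklow
    rw [Real.rpow_def_of_pos hnp]
    apply Real.exp_le_exp.2
    rw [mul_comm]
    apply mul_le_mul_of_nonneg_left _ (by linarith)
    linarith
  have hkp : (0:ℝ) < k n := lt_trans (Real.exp_pos _) hlow
  have hk1 : 1 ≤ k n := by exact_mod_cast hkp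
  have hk1R : (1:ℝ) ≤ k n := by exact_mod_cast hk1
  have hksm : (k n : ℝ) ≤ min ε (1/100) * n := by
    apply le_of_sq_le_sq _ (by positivity)
    have h1 := (Real.lt_sqrt hkp.le).1 hkup
    rw [div_lt_iff₀ hnp] at hkl
    have h2 : 0 ≤ n * Real.log n := by positivity
    have h3 := mul_le_mul_of_nonneg_right hkl.le hnp.le
    rw [mul_pow]
    nlinarith
  have hkε : (k n : ℝ) ≤ ε * n :=
    hksm.trans (mul_le_mul_of_nonneg_right (min_le_left _ _) hnp.le)
  have hk100 : (k n : ℝ) ≤ n / 100 := by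
    have := hksm.trans (mul_le_mul_of_nonneg_right (min_le_right _ _) hnp.le)
    linarith
  obtain ⟨hq0, hq1, hb⟩ := saib_asym n (k n) (p n) ε hε0 hε14 (hp0 n) hnk hL hlow hkup hkε hφ
  have hb' : wbar n (k n) (p n) * ((interProb n (k n))^8)⁻¹ * k n / n ≤ F n := hb
  have hw0 : 0 ≤ wbar n (k n) (p n) :=
    le_trans (by linarith : 0 ≤ 6 * Real.log n) (le_max_right _ _)
  have hwb : wbar n (k n) (p n) ≤ n / 100 := by
    have h1 : 1 ≤ ((interProb n (k n))^8)⁻¹ :=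
      (one_le_inv₀ (by positivity)).2 (pow_le_one₀ hq0.le hq1)
    have h2 : wbar n (k n) (p n) ≤ wbar n (k n) (p n) * ((interProb n (k n))^8)⁻¹ * k n := by
      rw [mul_assoc]
      apply le_mul_of_one_le_right hw0
      nlinarith
    have h3 := hb'.trans hF1.le
    rw [div_le_iff₀ hnp] at h3
    linarith
  have hqb : qbar n (k n) (p n) =
      interProb n (k n) + 2 * (k n:ℝ)^2 * wbar n (k n) (p n) / (n:ℝ)^2 := by
    unfold qbar
    field_simp
  have hqbp : 0 < qbar n (k n) (p n) := by
    rw [hqb]; positivity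
  have fin : ∀ (d : ℕ) (u : ℝ), u ≤ (interProb n (k n) + 2 * (k n:ℝ)^2 * wbar n (k n) (p n) / (n:ℝ)^2) ^ d *
        Real.exp (2 * (wbar n (k n) (p n) * ((interProb n (k n))^8)⁻¹ * k n / n)) →
      u < (1 + (Real.exp (2 * F n) - 1 + 1 / ((n:ℝ) + 1))) * qbar n (k n) (p n) ^ d := by
    intro d u hu
    rw [← hqb] at hu
    refine lt_of_le_of_lt hu ?_
    rw [mul_comm]
    apply mul_lt_mul_of_pos_right _ (pow_pos hqbp d)
    have h1 : Real.exp (2 * (wbar n (k n) (p n) * ((interProb n (k n))^8)⁻¹ * k n / n)) ≤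
        Real.exp (2 * F n) := Real.exp_le_exp.2 (by linarith)
    have h2 : (0:ℝ) < 1 / ((n:ℝ) + 1) := by positivity
    linarith
  constructor
  · intro x 𝒜 hA hx h8 hw
    exact fin _ _ (saib_partA n (k n) _ x hn hk1 hk100 hwb hq0 𝒜 hA hx h8 hw)
  · intro x y hxy 𝒜 hA hx h8 hw
    exact fin _ _ (saib_partB n (k n) _ x y hxy hn hk1 hk100 hwb hq0 𝒜 hA hx h8 hw)
end

section
/- Suppose a fixed 0<ε<1/4 is given, n^{1/2−o(1)} < k < sqrt((1/4−ε)·n·log n), Λ(Δ) < o(1) a.s. holds, and φ > φ* := log³n/log(1/q). Set ξ = log(1/q)/(2·log n) and r₀ = ξ·φ. Then almost surely there do not exist in H = H_k(n,p) a nontrivial clique C and a vertex x such that |C| ≥ max{φ/2, d_H(x)} and |C ∖ C_x| ≤ r₀. -/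
open Filter

/-! ### Helper lemmas -/

lemma aux_weight_total {β : Type*} [DecidableEq β] (S : Finset β) (p : ℝ) :
    ∑ H ∈ S.powerset, p ^ H.card * (1 - p) ^ (S.card - H.card) = 1 := by
  have h := Finset.prod_add (fun _ : β => p) (fun _ => 1 - p) S
  simp only [Finset.prod_const] at h
  have h2 : ∀ H ∈ S.powerset, p ^ H.card * (1 - p) ^ (S.card - H.card)
      = p ^ H.card * (1 - p) ^ (S \ H).card := by
    intro H hH
    rw [Finset.card_sdiff_of_subset (Finset.mem_powerset.1 hH)]
  rw [Finset.sum_congr rfl h2, ← h]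
  simp

lemma aux_hprob_not (n k : ℕ) (p : ℝ) (P : Finset (Finset (Fin n)) → Prop) :
    hprob n k p (fun H => ¬ P H) = 1 - hprob n k p P := by
  classical
  rw [eq_sub_iff_add_eq]
  unfold hprob
  rw [← Finset.sum_add_distrib]
  refine Eq.trans ?_ (aux_weight_total (kSets n k) p)
  refine Finset.sum_congr rfl fun H _ => ?_
  by_cases h : P H <;> simp [h]

lemma aux_hprob_nonneg (n k : ℕ) (p : ℝ) (hp0 : 0 ≤ p) (hp1 : p ≤ 1)
    (P : Finset (Finset (Fin n)) → Prop) : 0 ≤ hprob n k p P := by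
  unfold hprob
  refine Finset.sum_nonneg fun H _ => ?_
  have : 0 ≤ 1 - p := by linarith
  split_ifs <;> positivity

/-- Laplace-transform bound: `Pr(B ∈ H, |H ∩ T| ≤ r) ≤ p·exp(r - p|T|/2)`. -/
lemma aux_laplace (n k : ℕ) (p : ℝ) (hp0 : 0 ≤ p) (hp1 : p ≤ 1)
    (B : Finset (Fin n)) (hB : B ∈ kSets n k) (T : Finset (Finset (Fin n)))
    (hT : T ⊆ kSets n k) (hBT : B ∉ T) (r : ℝ) :
    hprob n k p (fun H => B ∈ H ∧ ((H ∩ T).card : ℝ) ≤ r)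
      ≤ p * Real.exp (r - p * T.card / 2) := by
  classical
  set S := kSets n k with hS
  set t : ℝ := Real.exp (-1) with ht
  have hq : 0 ≤ 1 - p := by linarith
  have key := Finset.prod_add (fun A : Finset (Fin n) => p * (if A ∈ T then t else 1))
    (fun A => (1 - p) * (if A = B then 0 else 1)) S
  have hterm : ∀ H ∈ S.powerset,
      (if B ∈ H ∧ ((H ∩ T).card : ℝ) ≤ r then p ^ H.card * (1 - p) ^ (S.card - H.card) else 0)
      ≤ Real.exp r * ((∏ A ∈ H, p * (if A ∈ T then t else 1)) *
          ∏ A ∈ S \ H, (1 - p) * (if A = B then 0 else 1)) := by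
    intro H hH
    have hHS := Finset.mem_powerset.1 hH
    split_ifs with hc
    · obtain ⟨hBH, hr⟩ := hc
      have e1 : ∏ A ∈ H, p * (if A ∈ T then t else 1)
          = p ^ H.card * t ^ (H ∩ T).card := by
        rw [Finset.prod_mul_distrib, Finset.prod_const, Finset.prod_ite_mem, Finset.prod_const]
      have e2 : ∏ A ∈ S \ H, (1 - p) * (if A = B then (0:ℝ) else 1)
          = (1 - p) ^ (S.card - H.card) := by
        rw [← Finset.card_sdiff_of_subset hHS, ← Finset.prod_const]
        refine Finset.prod_congr rfl fun A hA => ?_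
        have : A ≠ B := by
          rintro rfl
          exact (Finset.mem_sdiff.1 hA).2 hBH
        simp [this]
      rw [e1, e2]
      have e3 : 1 ≤ Real.exp r * t ^ (H ∩ T).card := by
        rw [ht, ← Real.exp_nat_mul, ← Real.exp_add]
        apply Real.one_le_exp
        linarith
      have e4 : 0 ≤ p ^ H.card * (1 - p) ^ (S.card - H.card) := by positivity
      nlinarith
    · apply mul_nonneg (Real.exp_pos r).le
      apply mul_nonneg
      · refine Finset.prod_nonneg fun A _ => mul_nonneg hp0 ?_
        split_ifs
        · exact (Real.exp_pos _).le
        · norm_num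
      · refine Finset.prod_nonneg fun A _ => mul_nonneg hq ?_
        split_ifs <;> norm_num
  have hsum : hprob n k p (fun H => B ∈ H ∧ ((H ∩ T).card : ℝ) ≤ r)
      ≤ Real.exp r * ∏ A ∈ S, (p * (if A ∈ T then t else 1) +
          (1 - p) * (if A = B then 0 else 1)) := by
    rw [key, Finset.mul_sum]
    unfold hprob
    refine le_trans (le_of_eq ?_) (Finset.sum_le_sum hterm)
    refine Finset.sum_congr rfl fun H _ => ?_
    congr
  refine hsum.trans ?_
  have ht2 : t ≤ 1 / 2 := by
    rw [ht, Real.exp_neg, inv_eq_one_div]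
    apply one_div_le_one_div_of_le (by norm_num)
    have := Real.add_one_le_exp (1:ℝ)
    linarith
  have hprod : ∏ A ∈ S, (p * (if A ∈ T then t else 1) + (1 - p) * (if A = B then 0 else 1))
      ≤ ∏ A ∈ S, ((if A = B then p else 1) * (if A ∈ T then Real.exp (-(p / 2)) else 1)) := by
    refine Finset.prod_le_prod (fun A _ => ?_) (fun A _ => ?_)
    · have : 0 ≤ t := (Real.exp_pos _).le
      split_ifs <;> simp <;> nlinarith
    · by_cases h1 : A = B
      · subst h1
        simp [hBT]
      · by_cases h2 : A ∈ T
        · simp only [h1, h2, if_true, if_false]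
          have := Real.add_one_le_exp (-(p / 2))
          nlinarith
        · simp [h1, h2]
  have heq : ∏ A ∈ S, ((if A = B then p else 1) * (if A ∈ T then Real.exp (-(p / 2)) else 1))
      = p * Real.exp (-(p / 2)) ^ T.card := by
    rw [Finset.prod_mul_distrib, Finset.prod_ite_mem, Finset.prod_const,
      Finset.inter_eq_right.2 hT, Finset.prod_ite_eq' S B (fun _ => p), if_pos hB]
  calc _ ≤ Real.exp r * (p * Real.exp (-(p / 2)) ^ T.card) := by
        rw [← heq]
        exact mul_le_mul_of_nonneg_left hprod (Real.exp_pos r).le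
    _ = p * Real.exp (r - p * T.card / 2) := by
        rw [← Real.exp_nat_mul, mul_left_comm, ← Real.exp_add]
        congr 2
        ring

/-- The `k`-sets through `x` that avoid `B`. -/
def auxT (n k : ℕ) (x : Fin n) (B : Finset (Fin n)) : Finset (Finset (Fin n)) :=
  (kSets n k).filter (fun A => x ∈ A ∧ Disjoint A B)

lemma aux_card_T (n k : ℕ) (hk : 1 ≤ k) (x : Fin n) (B : Finset (Fin n)) (hB : B ∈ kSets n k)
    (hx : x ∉ B) : (n - k - 1).choose (k - 1) ≤ (auxT n k x B).card := by
  classical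
  have hBc : B.card = k := (Finset.mem_powersetCard.1 hB).2
  have hc : (Finset.univ \ insert x B).card = n - k - 1 := by
    rw [Finset.card_sdiff_of_subset (Finset.subset_univ _), Finset.card_insert_of_notMem hx, hBc,
      Finset.card_univ, Fintype.card_fin]
    omega
  rw [← hc, ← Finset.card_powersetCard]
  have hxA : ∀ A ∈ Finset.powersetCard (k - 1) (Finset.univ \ insert x B), x ∉ A := by
    intro A hA hxA
    have := (Finset.mem_powersetCard.1 hA).1 hxA
    simp at this
  refine Finset.card_le_card_of_injOn (fun A => insert x A) ?_ ?_
  · intro A hA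
    have h1 := hxA A hA
    obtain ⟨h2, h3⟩ := Finset.mem_powersetCard.1 hA
    simp only [auxT, kSets, Finset.coe_filter, Set.mem_ofPred_eq, Finset.mem_powersetCard]
    refine ⟨⟨Finset.subset_univ _, ?_⟩, Finset.mem_insert_self _ _, ?_⟩
    · rw [Finset.card_insert_of_notMem h1, h3]
      omega
    · rw [Finset.disjoint_insert_left]
      refine ⟨hx, ?_⟩
      rw [Finset.disjoint_left]
      intro a ha hab
      have := h2 ha
      simp [hab] at this
  · intro A hA A' hA' h
    have h1 := hxA A hA
    have h2 := hxA A' hA'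
    have := congrArg (fun s => Finset.erase s x) h
    simpa [Finset.erase_insert h1, Finset.erase_insert h2] using this

/-- The deterministic part. -/
lemma aux_det {n k : ℕ} (H : Finset (Finset (Fin n))) (hH : H ⊆ kSets n k) (r : ℝ)
    (C : Finset (Finset (Fin n))) (hC : C ⊆ H) (x : Fin n) (hcl : IsClique C)
    (hnt : IsNontrivial C) (hd : (vdeg H x : ℝ) ≤ C.card)
    (hr : ((C \ starOf C x).card : ℝ) ≤ r) :
    ∃ B ∈ kSets n k, x ∉ B ∧ (B ∈ H ∧ ((H ∩ auxT n k x B).card : ℝ) ≤ r) := by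
  classical
  have : ∃ B ∈ C, x ∉ B := by
    by_contra h
    push Not at h
    exact hnt ⟨x, h⟩
  obtain ⟨B, hBC, hxB⟩ := this
  refine ⟨B, hH (hC hBC), hxB, hC hBC, ?_⟩
  have hsub : starOf C x ∪ (H ∩ auxT n k x B) ⊆ starOf H x := by
    intro A hA
    rcases Finset.mem_union.1 hA with hA | hA
    · obtain ⟨h1, h2⟩ := Finset.mem_filter.1 hA
      exact Finset.mem_filter.2 ⟨hC h1, h2⟩
    · obtain ⟨h1, h2⟩ := Finset.mem_inter.1 hA
      exact Finset.mem_filter.2 ⟨h1, (Finset.mem_filter.1 h2).2.1⟩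
  have hdis : Disjoint (starOf C x) (H ∩ auxT n k x B) := by
    rw [Finset.disjoint_left]
    intro A hA hA'
    have h1 := (Finset.mem_filter.1 hA).1
    have h2 := (Finset.mem_filter.1 (Finset.mem_inter.1 hA').2).2.2
    have h3 := hcl A h1 B hBC
    rw [Finset.disjoint_iff_inter_eq_empty] at h2
    simp [h2] at h3
  have hcard := Finset.card_le_card hsub
  rw [Finset.card_union_of_disjoint hdis] at hcard
  have hsplit : (C \ starOf C x).card + (starOf C x).card = C.card :=
    Finset.card_sdiff_add_card_eq_card (Finset.filter_subset _ _)
  have h1 : ((starOf C x).card : ℝ) + ((H ∩ auxT n k x B).card : ℝ) ≤ vdeg H x := by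
    exact_mod_cast hcard
  have h2 : ((C \ starOf C x).card : ℝ) + (starOf C x).card = C.card := by
    exact_mod_cast hsplit
  linarith

lemma aux_union (n k : ℕ) (p : ℝ) (hp0 : 0 ≤ p) (hp1 : p ≤ 1) (hk : 1 ≤ k) (r : ℝ)
    (P : Finset (Finset (Fin n)) → Prop)
    (hP : ∀ H ⊆ kSets n k, P H → ∃ x : Fin n,
      ∃ B ∈ kSets n k, x ∉ B ∧ (B ∈ H ∧ ((H ∩ auxT n k x B).card : ℝ) ≤ r)) :
    hprob n k p P ≤ n * (n.choose k * (p *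
      Real.exp (r - p * ((n - k - 1).choose (k - 1) : ℝ) / 2))) := by
  classical
  have hq : 0 ≤ 1 - p := by linarith
  have h1 : hprob n k p P ≤ ∑ x : Fin n, ∑ B ∈ (kSets n k).filter (fun B => x ∉ B),
      hprob n k p (fun H => B ∈ H ∧ ((H ∩ auxT n k x B).card : ℝ) ≤ r) := by
    unfold hprob
    have hswap : ∀ x : Fin n, ∀ f : Finset (Fin n) → Finset (Finset (Fin n)) → ℝ,
        ∑ B ∈ (kSets n k).filter (fun B => x ∉ B), ∑ H ∈ (kSets n k).powerset, f B H
        = ∑ H ∈ (kSets n k).powerset, ∑ B ∈ (kSets n k).filter (fun B => x ∉ B), f B H :=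
      fun x f => Finset.sum_comm
    simp_rw [hswap]
    rw [Finset.sum_comm]
    refine Finset.sum_le_sum fun H hH => ?_
    have hw : 0 ≤ p ^ H.card * (1 - p) ^ ((kSets n k).card - H.card) := by positivity
    have hnn : ∀ (c : Prop) {_ : Decidable c},
        0 ≤ (if c then p ^ H.card * (1 - p) ^ ((kSets n k).card - H.card) else 0) := by
      intro c _
      split_ifs
      · exact hw
      · exact le_rfl
    split_ifs with hPH
    · obtain ⟨x, B, hB, hxB, hc⟩ := hP H (Finset.mem_powerset.1 hH) hPH
      refine le_trans ?_ (Finset.single_le_sum (fun x _ =>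
        Finset.sum_nonneg fun B _ => hnn _) (Finset.mem_univ x))
      refine le_trans ?_ (Finset.single_le_sum (fun B _ => hnn _)
        (Finset.mem_filter.2 ⟨hB, hxB⟩))
      rw [if_pos hc]
    · exact Finset.sum_nonneg fun x _ => Finset.sum_nonneg fun B _ => hnn _
  refine h1.trans ?_
  have h2 : ∀ x : Fin n, ∑ B ∈ (kSets n k).filter (fun B => x ∉ B),
      hprob n k p (fun H => B ∈ H ∧ ((H ∩ auxT n k x B).card : ℝ) ≤ r)
      ≤ n.choose k * (p * Real.exp (r - p * ((n - k - 1).choose (k - 1) : ℝ) / 2)) := by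
    intro x
    have hb : ∀ B ∈ (kSets n k).filter (fun B => x ∉ B),
        hprob n k p (fun H => B ∈ H ∧ ((H ∩ auxT n k x B).card : ℝ) ≤ r)
        ≤ p * Real.exp (r - p * ((n - k - 1).choose (k - 1) : ℝ) / 2) := by
      intro B hB
      obtain ⟨hB1, hB2⟩ := Finset.mem_filter.1 hB
      have hBT : B ∉ auxT n k x B := fun h => hB2 (Finset.mem_filter.1 h).2.1
      refine (aux_laplace n k p hp0 hp1 B hB1 (auxT n k x B) (Finset.filter_subset _ _)
        hBT r).trans ?_
      have hc : ((n - k - 1).choose (k - 1) : ℝ) ≤ (auxT n k x B).card := by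
        exact_mod_cast aux_card_T n k hk x B hB1 hB2
      gcongr
    refine (Finset.sum_le_card_nsmul _ _ _ hb).trans ?_
    rw [nsmul_eq_mul]
    have hc : (((kSets n k).filter (fun B => x ∉ B)).card : ℝ) ≤ n.choose k := by
      have := Finset.card_filter_le (kSets n k) (fun B => x ∉ B)
      rw [kSets, Finset.card_powersetCard, Finset.card_univ, Fintype.card_fin] at this
      exact_mod_cast this
    exact mul_le_mul_of_nonneg_right hc (mul_nonneg hp0 (Real.exp_pos _).le)
  refine (Finset.sum_le_sum fun x _ => h2 x).trans ?_
  rw [Finset.sum_const, nsmul_eq_mul, Finset.card_univ, Fintype.card_fin]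

lemma aux_interProb (n k : ℕ) (hnk : k ≤ n) :
    interProb n k = 1 - ((n - k).choose k : ℝ) / (n.choose k : ℝ) := by
  classical
  have hcard : (kSets n k).card = n.choose k := by
    rw [kSets, Finset.card_powersetCard, Finset.card_univ, Fintype.card_fin]
  have hpos : (0 : ℝ) < n.choose k := by exact_mod_cast Nat.choose_pos hnk
  have hdis : (((kSets n k) ×ˢ (kSets n k)).filter
      fun AB => ¬ (AB.1 ∩ AB.2).Nonempty).card = n.choose k * (n - k).choose k := by
    rw [Finset.card_filter, Finset.sum_product]
    have : ∀ A ∈ kSets n k, (∑ B ∈ kSets n k, if ¬ (A ∩ B).Nonempty then 1 else 0)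
        = (n - k).choose k := by
      intro A hA
      have hAc : A.card = k := (Finset.mem_powersetCard.1 hA).2
      rw [← Finset.card_filter]
      have : (kSets n k).filter (fun B => ¬ (A ∩ B).Nonempty) = Finset.powersetCard k Aᶜ := by
        ext B
        simp only [kSets, Finset.mem_filter, Finset.mem_powersetCard, Finset.subset_univ, true_and,
          Finset.not_nonempty_iff_eq_empty, ← Finset.disjoint_iff_inter_eq_empty]
        rw [Finset.subset_compl_iff_disjoint_right, and_comm, disjoint_comm]
      rw [this, Finset.card_powersetCard, Finset.card_compl, hAc, Fintype.card_fin]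
    rw [Finset.sum_congr rfl this, Finset.sum_const, hcard, smul_eq_mul]
  have htot := Finset.card_filter_add_card_filter_not (s := (kSets n k) ×ˢ (kSets n k))
    (fun AB : Finset (Fin n) × Finset (Fin n) => (AB.1 ∩ AB.2).Nonempty)
  rw [hdis, Finset.card_product, hcard] at htot
  have htot' : ((((kSets n k) ×ˢ (kSets n k)).filter
      fun AB => (AB.1 ∩ AB.2).Nonempty).card : ℝ) + n.choose k * (n - k).choose k
      = n.choose k * n.choose k := by exact_mod_cast htot
  unfold interProb
  rw [hcard]
  field_simp
  convert (eq_sub_of_add_eq htot') using 1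
  ring

lemma aux_desc_upper (n k : ℕ) (hn : 0 < n) (hnk : 2 * k ≤ n) (j : ℕ) (hj : j ≤ k) :
    ((n - k).descFactorial j : ℝ) ≤ (1 - (k : ℝ) / n) ^ j * n.descFactorial j := by
  have hn' : (0 : ℝ) < n := by exact_mod_cast hn
  induction j with
  | zero => simp
  | succ j ih =>
    have ih := ih (by omega)
    rw [Nat.descFactorial_succ, Nat.descFactorial_succ, Nat.cast_mul, Nat.cast_mul, pow_succ]
    have e1 : ((n - k - j : ℕ) : ℝ) = n - k - j := by
      rw [Nat.cast_sub (by omega), Nat.cast_sub (by omega)]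
    have e2 : ((n - j : ℕ) : ℝ) = n - j := by rw [Nat.cast_sub (by omega)]
    have e3 : ((n - k - j : ℕ) : ℝ) ≤ (1 - (k : ℝ) / n) * ((n - j : ℕ) : ℝ) := by
      rw [e1, e2]
      have : (1 - (k : ℝ) / n) * ((n : ℝ) - j) = n - k - j + k * j / n := by
        field_simp
        ring
      rw [this]
      have : (0 : ℝ) ≤ (k : ℝ) * j / n := by positivity
      linarith
    calc ((n - k - j : ℕ) : ℝ) * ((n - k).descFactorial j : ℝ)
        ≤ ((1 - (k : ℝ) / n) * ((n - j : ℕ) : ℝ)) *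
          ((1 - (k : ℝ) / n) ^ j * n.descFactorial j) := by
          apply mul_le_mul e3 ih (by positivity) (le_trans (by positivity) e3)
      _ = _ := by ring

lemma aux_desc_lower (n k : ℕ) (hn : 0 < n) (hnk : 2 * k < n) (j : ℕ) (hj : j ≤ k) :
    (1 - (k : ℝ) / (n - k)) ^ j * n.descFactorial j ≤ ((n - k).descFactorial j : ℝ) := by
  have hk2 : (2 : ℝ) * k < n := by exact_mod_cast hnk
  have hk0 : (0 : ℝ) ≤ k := by positivity
  have hnk' : (0 : ℝ) < (n : ℝ) - k := by linarith
  have hu : 0 ≤ 1 - (k : ℝ) / (n - k) := by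
    rw [sub_nonneg, div_le_one hnk']
    linarith
  induction j with
  | zero => simp
  | succ j ih =>
    have ih := ih (by omega)
    rw [Nat.descFactorial_succ, Nat.descFactorial_succ, Nat.cast_mul, Nat.cast_mul, pow_succ]
    have e1 : ((n - k - j : ℕ) : ℝ) = n - k - j := by
      rw [Nat.cast_sub (by omega), Nat.cast_sub (by omega)]
    have e2 : ((n - j : ℕ) : ℝ) = n - j := by rw [Nat.cast_sub (by omega)]
    have hjk : (j : ℝ) ≤ k := by exact_mod_cast (by omega : j ≤ k)
    have e3 : (1 - (k : ℝ) / (n - k)) * ((n - j : ℕ) : ℝ) ≤ ((n - k - j : ℕ) : ℝ) := by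
      rw [e1, e2]
      have h4 : (k : ℝ) ≤ (k : ℝ) / (n - k) * (n - j) := by
        rw [div_mul_eq_mul_div, le_div_iff₀ hnk']
        nlinarith
      linarith
    calc (1 - (k : ℝ) / (n - k)) ^ j * (1 - (k : ℝ) / (n - k)) *
          (((n - j : ℕ) : ℝ) * n.descFactorial j)
        = ((1 - (k : ℝ) / (n - k)) * ((n - j : ℕ) : ℝ)) *
          ((1 - (k : ℝ) / (n - k)) ^ j * n.descFactorial j) := by ring
      _ ≤ _ := by
          apply mul_le_mul e3 ih (by positivity) (by positivity)

lemma aux_ratio_eq (n k : ℕ) :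
    ((n - k).choose k : ℝ) / (n.choose k : ℝ)
      = ((n - k).descFactorial k : ℝ) / (n.descFactorial k : ℝ) := by
  rw [Nat.descFactorial_eq_factorial_mul_choose, Nat.descFactorial_eq_factorial_mul_choose]
  push_cast
  rw [mul_div_mul_left]
  positivity

lemma aux_ratio_upper (n k : ℕ) (hn : 0 < n) (hnk : 2 * k ≤ n) :
    ((n - k).choose k : ℝ) / (n.choose k : ℝ) ≤ Real.exp (-((k : ℝ) ^ 2 / n)) := by
  have hn' : (0 : ℝ) < n := by exact_mod_cast hn
  have hk2 : (2 : ℝ) * k ≤ n := by exact_mod_cast hnk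
  have hk0 : (0 : ℝ) ≤ k := by positivity
  rw [aux_ratio_eq]
  have hpos : (0 : ℝ) < n.descFactorial k := by
    exact_mod_cast Nat.descFactorial_pos.2 (by omega)
  rw [div_le_iff₀ hpos]
  refine (aux_desc_upper n k hn hnk k le_rfl).trans ?_
  apply mul_le_mul_of_nonneg_right _ hpos.le
  have h1 : 1 - (k : ℝ) / n ≤ Real.exp (-((k : ℝ) / n)) := by
    have := Real.add_one_le_exp (-((k : ℝ) / n))
    linarith
  have h0 : 0 ≤ 1 - (k : ℝ) / n := by
    rw [sub_nonneg, div_le_one hn']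
    linarith
  calc (1 - (k : ℝ) / n) ^ k ≤ Real.exp (-((k : ℝ) / n)) ^ k := pow_le_pow_left₀ h0 h1 k
    _ = _ := by
      rw [← Real.exp_nat_mul]
      congr 1
      ring

lemma aux_ratio_lower (n k : ℕ) (hn : 0 < n) (hnk : 3 * k ≤ n) :
    Real.exp (-(4 * (k : ℝ) ^ 2 / n)) ≤ ((n - k).choose k : ℝ) / (n.choose k : ℝ) := by
  have hn' : (0 : ℝ) < n := by exact_mod_cast hn
  have hk3 : (3 : ℝ) * k ≤ n := by exact_mod_cast hnk
  have hk0 : (0 : ℝ) ≤ k := by positivity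
  rw [aux_ratio_eq]
  have hpos : (0 : ℝ) < n.descFactorial k := by
    exact_mod_cast Nat.descFactorial_pos.2 (by omega)
  rw [le_div_iff₀ hpos]
  refine le_trans ?_ (aux_desc_lower n k hn (by omega) k le_rfl)
  apply mul_le_mul_of_nonneg_right _ hpos.le
  have hnk' : (0 : ℝ) < (n : ℝ) - k := by linarith
  set u : ℝ := (k : ℝ) / (n - k) with hu
  have hu0 : 0 ≤ u := by positivity
  have hu1 : u ≤ 1 / 2 := by
    rw [hu, div_le_iff₀ hnk']
    linarith
  have hu2 : u ≤ 2 * k / n := by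
    rw [hu, div_le_div_iff₀ hnk' hn']
    nlinarith
  have h1 : Real.exp (-(2 * u)) ≤ 1 - u := by
    rw [Real.exp_neg, inv_eq_one_div, div_le_iff₀ (Real.exp_pos _)]
    have := Real.add_one_le_exp (2 * u)
    nlinarith
  calc Real.exp (-(4 * (k : ℝ) ^ 2 / n)) ≤ Real.exp (-(2 * u)) ^ k := by
        rw [← Real.exp_nat_mul]
        apply Real.exp_le_exp.2
        have : (k : ℝ) * u ≤ k * (2 * k / n) := mul_le_mul_of_nonneg_left hu2 hk0
        have e : 4 * (k : ℝ) ^ 2 / n = 2 * (k * (2 * k / n)) := by ring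
        rw [e]
        linarith
    _ ≤ _ := pow_le_pow_left₀ (Real.exp_pos _).le h1 k

lemma aux_choose_ineq (n k : ℕ) (hk : 1 ≤ k) (hnk : 2 * k < n) :
    (((n - k).choose k : ℝ) / (n.choose k : ℝ)) * ((n - 1).choose (k - 1) : ℝ)
      ≤ ((n - k - 1).choose (k - 1) : ℝ) := by
  have h1 : n * (n - 1).choose (k - 1) = n.choose k * k := by
    have := Nat.add_one_mul_choose_eq (n - 1) (k - 1)
    rwa [Nat.sub_add_cancel (by omega), Nat.sub_add_cancel hk] at this
  have h2 : (n - k) * (n - k - 1).choose (k - 1) = (n - k).choose k * k := by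
    have := Nat.add_one_mul_choose_eq (n - k - 1) (k - 1)
    rwa [Nat.sub_add_cancel (by omega), Nat.sub_add_cancel hk] at this
  have hpos : (0 : ℝ) < n.choose k := by exact_mod_cast Nat.choose_pos (by omega)
  have hn : (0 : ℝ) < n := by exact_mod_cast (by omega : 0 < n)
  have hle : (n - k) * (n - k - 1).choose (k - 1) ≤ n * (n - k - 1).choose (k - 1) :=
    Nat.mul_le_mul_right _ (by omega)
  rw [h2] at hle
  have h1' : (n : ℝ) * (n - 1).choose (k - 1) = n.choose k * k := by exact_mod_cast h1
  have hle' : ((n - k).choose k : ℝ) * k ≤ n * (n - k - 1).choose (k - 1) := by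
    exact_mod_cast hle
  rw [div_mul_eq_mul_div, div_le_iff₀ hpos]
  have hgoal : (n : ℝ) * (((n - k).choose k : ℝ) * ((n - 1).choose (k - 1) : ℝ))
      ≤ n * (((n - k - 1).choose (k - 1) : ℝ) * n.choose k) := by
    calc (n : ℝ) * (((n - k).choose k : ℝ) * ((n - 1).choose (k - 1) : ℝ))
        = ((n - k).choose k : ℝ) * (n * ((n - 1).choose (k - 1) : ℝ)) := by ring
      _ = (((n - k).choose k : ℝ) * k) * n.choose k := by rw [h1']; ring
      _ ≤ (n * (n - k - 1).choose (k - 1)) * n.choose k :=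
          mul_le_mul_of_nonneg_right hle' hpos.le
      _ = _ := by ring
  exact le_of_mul_le_mul_left hgoal hn

/-- The analytic part: with `R = 1 - q`. -/
lemma aux_log_q (L y R : ℝ) (hL : 8 ≤ L) (hy : Real.exp (-(L / 8)) ≤ y)
    (hR0 : 0 < R) (hR : R ≤ Real.exp (-y)) :
    0 < Real.log (1 / (1 - R)) ∧ Real.log (1 / (1 - R)) ≤ R * L / 2 := by
  have hy0 : 0 < y := lt_of_lt_of_le (Real.exp_pos _) hy
  have hR1 : R < 1 := lt_of_le_of_lt hR (by rw [Real.exp_lt_one_iff]; linarith)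
  refine ⟨Real.log_pos ((one_lt_div (by linarith)).2 (by linarith)), ?_⟩
  by_cases hc : R ≤ 1 / 2
  · have h1 := Real.log_le_sub_one_of_pos (x := 1 / (1 - R)) (by
      apply one_div_pos.2
      linarith)
    have h2 : 1 / (1 - R) - 1 ≤ 2 * R := by
      rw [sub_le_iff_le_add, div_le_iff₀ (by linarith)]
      nlinarith
    nlinarith
  · push Not at hc
    set z := Real.exp (-(L / 8)) with hz
    have hz0 : 0 < z := Real.exp_pos _
    have hz1 : z ≤ 1 / 2 := by
      have : z ≤ Real.exp (-1) := Real.exp_le_exp.2 (by linarith)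
      refine this.trans ?_
      rw [Real.exp_neg, inv_eq_one_div]
      apply one_div_le_one_div_of_le (by norm_num)
      have := Real.add_one_le_exp (1:ℝ)
      linarith
    have h1 : Real.exp (-y) ≤ 1 / (1 + z) := by
      rw [Real.exp_neg, inv_eq_one_div]
      apply one_div_le_one_div_of_le (by linarith)
      have := Real.add_one_le_exp y
      linarith
    have h2 : 1 / (1 + z) ≤ 1 - z ^ 2 := by
      rw [div_le_iff₀ (by linarith)]
      nlinarith [mul_pos hz0 hz0]
    have h3 : z ^ 2 ≤ 1 - R := by linarith
    have hz2 : z ^ 2 = Real.exp (-(L / 4)) := by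
      rw [hz, ← Real.exp_nat_mul]
      congr 1
      push_cast
      ring
    have h4 : Real.log (1 / (1 - R)) ≤ L / 4 := by
      rw [one_div, Real.log_inv]
      have : Real.log (Real.exp (-(L / 4))) ≤ Real.log (1 - R) := by
        apply Real.log_le_log (Real.exp_pos _)
        rw [← hz2]
        exact h3
      rw [Real.log_exp] at this
      linarith
    nlinarith

/-- Final numeric bound. -/
lemma aux_final (L φ R l : ℝ) (hL : 16 ≤ L) (hR0 : Real.exp (-L) ≤ R)
    (hl0 : 0 < l) (hl : l ≤ R * L / 2) (hφ : L ^ 3 / l < φ) :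
    Real.exp L * (Real.exp L * (φ * Real.exp (l / (2 * L) * φ - φ * R / 2)))
      ≤ 4 * Real.exp (-L) := by
  have hφ0 : 0 < φ := lt_trans (by positivity) hφ
  have hRp : 0 < R := lt_of_lt_of_le (Real.exp_pos _) hR0
  set M := φ * R / 4 with hM
  have h1 : l / (2 * L) ≤ R / 4 := by
    rw [div_le_iff₀ (by positivity)]
    linarith
  have h2 : l / (2 * L) * φ - φ * R / 2 ≤ -M := by
    have := mul_le_mul_of_nonneg_right h1 hφ0.le
    rw [hM]
    linarith
  have h3 : L ^ 2 / 2 ≤ M := by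
    rw [div_lt_iff₀ hl0] at hφ
    have h5 : L ^ 3 < φ * (R * L / 2) := lt_of_lt_of_le hφ (mul_le_mul_of_nonneg_left hl hφ0.le)
    have h6 : L * (L ^ 2 / 2) < L * M := by
      rw [hM]
      nlinarith
    exact (lt_of_mul_lt_mul_left h6 (by linarith)).le
  have h4 : φ ≤ 4 * M * Real.exp L := by
    have : 1 ≤ R * Real.exp L := by
      have := mul_le_mul_of_nonneg_right hR0 (Real.exp_pos L).le
      rwa [← Real.exp_add, neg_add_cancel, Real.exp_zero] at this
    rw [hM]
    nlinarith
  have hM0 : 0 ≤ M := by positivity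
  have h5 : M ≤ Real.exp (M / 2) := by
    have := Real.quadratic_le_exp_of_nonneg (x := M / 2) (by positivity)
    nlinarith [sq_nonneg (M / 2 - 1)]
  calc Real.exp L * (Real.exp L * (φ * Real.exp (l / (2 * L) * φ - φ * R / 2)))
      ≤ Real.exp L * (Real.exp L * ((4 * Real.exp (M / 2) * Real.exp L) * Real.exp (-M))) := by
        gcongr
        exact h4.trans (by gcongr)
    _ = 4 * Real.exp (3 * L - M / 2) := by
        have : 3 * L - M / 2 = L + (L + (M / 2 + L + -M)) := by ring
        rw [this, Real.exp_add, Real.exp_add, Real.exp_add, Real.exp_add]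
        ring
    _ ≤ 4 * Real.exp (-L) := by
        gcongr
        nlinarith

lemma aux_main_bound (n k : ℕ) (p : ℝ) (hp0 : 0 ≤ p) (hp1 : p ≤ 1) (hn : 0 < n)
    (hk : 1 ≤ k) (hnk : 3 * k ≤ n) (hL : 16 ≤ Real.log n)
    (hy : Real.exp (-(Real.log n / 8)) ≤ (k : ℝ) ^ 2 / n)
    (hy2 : 4 * (k : ℝ) ^ 2 / n ≤ Real.log n)
    (hφ : phiStar n k < phi n k p) (P : Finset (Finset (Fin n)) → Prop)
    (hP : ∀ H ⊆ kSets n k, P H → ∃ x : Fin n,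
      ∃ B ∈ kSets n k, x ∉ B ∧ (B ∈ H ∧ ((H ∩ auxT n k x B).card : ℝ) ≤
        (Real.log (1 / interProb n k) / (2 * Real.log n)) * phi n k p)) :
    hprob n k p P ≤ 4 / n := by
  have hn' : (0 : ℝ) < n := by exact_mod_cast hn
  set R : ℝ := ((n - k).choose k : ℝ) / (n.choose k : ℝ) with hR
  have hq : interProb n k = 1 - R := aux_interProb n k (by omega)
  have hRlow : Real.exp (-Real.log n) ≤ R :=
    le_trans (Real.exp_le_exp.2 (by linarith)) (aux_ratio_lower n k hn hnk)
  have hR0 : 0 < R := lt_of_lt_of_le (Real.exp_pos _) hRlow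
  obtain ⟨hl0, hl⟩ := aux_log_q (Real.log n) _ R (by linarith) hy hR0
    (aux_ratio_upper n k hn (by omega))
  rw [phiStar, hq] at hφ
  have hfin := aux_final (Real.log n) (phi n k p) R _ hL hRlow hl0 hl hφ
  have hexp : Real.exp (Real.log n) = n := Real.exp_log hn'
  rw [Real.exp_neg, hexp] at hfin
  refine (aux_union n k p hp0 hp1 hk _ P hP).trans ?_
  rw [hq]
  refine le_trans ?_ (hfin.trans (le_of_eq (by rw [div_eq_mul_inv])))
  have h1 : (n : ℝ) * (n - 1).choose (k - 1) = n.choose k * k := by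
    have := Nat.add_one_mul_choose_eq (n - 1) (k - 1)
    rw [Nat.sub_add_cancel (by omega), Nat.sub_add_cancel hk] at this
    exact_mod_cast this
  have h2 : (n.choose k : ℝ) ≤ n * (n - 1).choose (k - 1) := by
    rw [h1]
    have : (1 : ℝ) ≤ k := by exact_mod_cast hk
    have h0 : (0 : ℝ) ≤ n.choose k := by positivity
    nlinarith
  have h3 : phi n k p * R ≤ p * ((n - k - 1).choose (k - 1) : ℝ) := by
    have := mul_le_mul_of_nonneg_left (aux_choose_ineq n k hk (by omega)) hp0
    rw [phi]
    calc _ = p * (R * ((n - 1).choose (k - 1) : ℝ)) := by ring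
      _ ≤ _ := this
  calc (n : ℝ) * (n.choose k * (p * Real.exp (Real.log (1 / (1 - R)) / (2 * Real.log n) * phi n k p
        - p * ((n - k - 1).choose (k - 1) : ℝ) / 2)))
      ≤ n * ((n * (n - 1).choose (k - 1)) * (p * Real.exp (Real.log (1 / (1 - R)) /
          (2 * Real.log n) * phi n k p - phi n k p * R / 2))) := by
        gcongr
    _ = _ := by
        rw [phi]
        ring

/-- **Lemma (large `φ`).** Under the standing assumptions with `φ > φ*`, setting
`ξ = log(1/q)/(2 log n)` and `r₀ = ξ φ`: almost surely there do not exist in `H_k(n,p)`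
a nontrivial clique `C` and a vertex `x` with `|C| ≥ max{φ/2, d_H(x)}` and
`|C ∖ C_x| ≤ r₀`. -/
theorem no_almost_trivial_clique_large_phi
    (ε : ℝ) (hε0 : 0 < ε) (hε14 : ε < 1 / 4)
    (k : ℕ → ℕ) (p : ℕ → ℝ)
    (hp0 : ∀ n, 0 ≤ p n) (hp1 : ∀ n, p n ≤ 1)
    (hnk : ∀ᶠ n in atTop, 2 * k n < n)
    (δ : ℕ → ℝ) (hδ : Tendsto δ atTop (nhds 0))
    (hklow : ∀ᶠ n : ℕ in atTop, (n : ℝ) ^ ((1 : ℝ) / 2 - δ n) < (k n : ℝ))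
    (hkup : ∀ᶠ n in atTop, (k n : ℝ) < Real.sqrt ((1 / 4 - ε) * n * Real.log n))
    (σ υ : ℕ → ℝ) (hσ : Tendsto σ atTop (nhds 0)) (hυ : Tendsto υ atTop (nhds 0))
    (hLam : ∀ᶠ n in atTop,
      hprob n (k n) (p n) (fun H => σ n < Lam n (k n) (p n) (maxDegree H)) < υ n)
    (hφ : ∀ᶠ n in atTop, phiStar n (k n) < phi n (k n) (p n))
    :
    Tendsto (fun n => hprob n (k n) (p n) (fun H =>
      ¬ ∃ C ⊆ H, ∃ x : Fin n, IsClique C ∧ IsNontrivial C ∧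
        max (phi n (k n) (p n) / 2) ((vdeg H x : ℝ)) ≤ (C.card : ℝ) ∧
        ((C \ starOf C x).card : ℝ) ≤
          (Real.log (1 / interProb n (k n)) / (2 * Real.log n)) * phi n (k n) (p n)))
      atTop (nhds 1) := by
  have hLt : Tendsto (fun n : ℕ => Real.log n) atTop atTop :=
    Real.tendsto_log_atTop.comp tendsto_natCast_atTop_atTop
  have hbad : ∀ᶠ n in atTop, hprob n (k n) (p n) (fun H =>
      ∃ C ⊆ H, ∃ x : Fin n, IsClique C ∧ IsNontrivial C ∧
        max (phi n (k n) (p n) / 2) ((vdeg H x : ℝ)) ≤ (C.card : ℝ) ∧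
        ((C \ starOf C x).card : ℝ) ≤
          (Real.log (1 / interProb n (k n)) / (2 * Real.log n)) * phi n (k n) (p n))
      ≤ 4 / (n : ℝ) := by
    have hδ' : ∀ᶠ n in atTop, δ n < 1 / 16 := hδ.eventually (gt_mem_nhds (by norm_num))
    have hlogn : ∀ᶠ n : ℕ in atTop, Real.log n ≤ 4 / 9 * n := by
      have := (Real.isLittleO_log_id_atTop.comp_tendsto tendsto_natCast_atTop_atTop).bound
        (show (0 : ℝ) < 4 / 9 by norm_num)
      filter_upwards [this] with n hn
      simp only [Function.comp, id, Real.norm_eq_abs] at hn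
      rw [abs_of_nonneg (Nat.cast_nonneg n : (0 : ℝ) ≤ (n : ℝ))] at hn
      exact (le_abs_self _).trans hn
    filter_upwards [hklow, hkup, hφ, hδ', hlogn, hLt.eventually_ge_atTop 16,
      eventually_gt_atTop 0] with n h1 h2 h3 h4 h5 h6 h7
    have hn' : (0 : ℝ) < n := by exact_mod_cast h7
    have hkpos : (0 : ℝ) < k n := lt_of_le_of_lt (by positivity) h1
    have hk1 : 1 ≤ k n := by exact_mod_cast hkpos
    have hsq : (k n : ℝ) ^ 2 < (1 / 4 - ε) * n * Real.log n := by
      rwa [Real.lt_sqrt hkpos.le] at h2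
    have hsq' : (k n : ℝ) ^ 2 ≤ 1 / 4 * n * Real.log n := by
      have : 0 ≤ ε * n * Real.log n := by
        have : 0 ≤ Real.log n := by linarith
        positivity
      nlinarith
    refine aux_main_bound n (k n) (p n) (hp0 n) (hp1 n) h7 hk1 ?_ h6 ?_ ?_ h3 _ ?_
    · have : (3 * (k n : ℝ)) ^ 2 ≤ (n : ℝ) ^ 2 := by
        have := mul_le_mul_of_nonneg_left h5 hn'.le
        nlinarith
      have := (sq_le_sq₀ (by positivity) hn'.le).1 this
      exact_mod_cast this
    · rw [le_div_iff₀ hn']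
      have e1 : Real.exp (Real.log n * (7 / 16)) ≤ k n := by
        rw [Real.rpow_def_of_pos hn'] at h1
        refine le_trans (Real.exp_le_exp.2 ?_) h1.le
        apply mul_le_mul_of_nonneg_left _ (by linarith)
        linarith
      calc Real.exp (-(Real.log n / 8)) * n
          = Real.exp (-(Real.log n / 8)) * Real.exp (Real.log n) := by rw [Real.exp_log hn']
        _ = Real.exp (Real.log n * (7 / 16)) ^ 2 := by
            rw [← Real.exp_add, ← Real.exp_nat_mul]
            congr 1
            push_cast
            ring
        _ ≤ (k n : ℝ) ^ 2 := pow_le_pow_left₀ (Real.exp_pos _).le e1 2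
    · rw [div_le_iff₀ hn']
      linarith
    · rintro H hH ⟨C, hC, x, hcl, hnt, hmax, hr⟩
      exact ⟨x, aux_det H hH _ C hC x hcl hnt ((le_max_right _ _).trans hmax) hr⟩
  have hlim : Tendsto (fun n : ℕ => 4 / (n : ℝ)) atTop (nhds 0) :=
    tendsto_const_div_atTop_nhds_zero_nat 4
  simp_rw [aux_hprob_not]
  have hz := squeeze_zero' (Eventually.of_forall fun n =>
    aux_hprob_nonneg n (k n) (p n) (hp0 n) (hp1 n) _) hbad hlim
  simpa using hz.const_sub 1
end

section
/- Let n > 2k, let A_1,…,A_m be chosen uniformly and independently from the k-subsets of [n], and let Δ denote the maximum vertex degree of the multiset {A_1,…,A_m}. Let α, C and s ∈ [m] be positive integers, t = m − s, S a subset of [m] of size s, and D an s-element multiset of k-subsets of [n] with maximum vertex degree at most C. If Pr(Bin(t, k/n) ≥ α − C) = ρ/n, then |Pr(Δ ≤ α | (A_i)_{i∈S} = D) − Pr(Δ ≤ α)| ≤ skρ/n + n·(sk/n)^{C+1}. -/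
open Filter

namespace CMD

open Finset

lemma up_eq {α : Type*} (s : Finset α) (E : α → Prop) [DecidablePred E] :
    uprob s E = ((s.filter E).card : ℝ) / (s.card : ℝ) := by
  unfold uprob
  congr

open Classical in
lemma up_mono {α : Type*} (s : Finset α) (E F : α → Prop) (h : ∀ x ∈ s, E x → F x) :
    uprob s E ≤ uprob s F := by
  unfold uprob
  gcongr with x hx
  exact h x hx

open Classical in
lemma up_nonneg {α : Type*} (s : Finset α) (E : α → Prop) : 0 ≤ uprob s E := by
  unfold uprob; positivity

open Classical in
lemma up_or {α : Type*} (s : Finset α) (E F : α → Prop) :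
    uprob s (fun x => E x ∨ F x) ≤ uprob s E + uprob s F := by
  simp only [up_eq]
  rw [← add_div]
  gcongr
  rw [filter_or]
  exact_mod_cast card_union_le _ _

open Classical in
lemma up_exists {α ι : Type*} (s : Finset α) (I : Finset ι) (E : ι → α → Prop) :
    uprob s (fun x => ∃ i ∈ I, E i x) ≤ ∑ i ∈ I, uprob s (E i) := by
  simp only [up_eq]
  rw [← sum_div]
  gcongr
  have : (s.filter fun x => ∃ i ∈ I, E i x) = I.biUnion fun i => s.filter (E i) := by
    ext x; simp; tauto
  rw [this]
  exact_mod_cast card_biUnion_le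

open Classical in
lemma indep {β : Type*} {m : ℕ} (K : Finset β) (S : Finset (Fin m))
    (A B : (Fin m → β) → Prop) [DecidablePred A] [DecidablePred B]
    (hA : ∀ f g, (∀ i ∈ S, f i = g i) → A f → A g)
    (hB : ∀ f g, (∀ i ∉ S, f i = g i) → B f → B g) :
    ((Fintype.piFinset fun _ : Fin m => K).filter fun f => A f ∧ B f).card *
      (Fintype.piFinset fun _ : Fin m => K).card =
    ((Fintype.piFinset fun _ : Fin m => K).filter A).card *
    ((Fintype.piFinset fun _ : Fin m => K).filter B).card := by
  rw [← card_product, ← card_product]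
  have key : ∀ f g : Fin m → β, S.piecewise (S.piecewise f g) (S.piecewise g f) = f := by
    intro f g; ext i; by_cases h : i ∈ S <;> simp [h]
  have hmem : ∀ f g : Fin m → β, (∀ i, f i ∈ K) → (∀ i, g i ∈ K) →
      ∀ i, S.piecewise f g i ∈ K := by
    intro f g hf hg i; by_cases h : i ∈ S <;> simp [h, hf, hg]
  refine card_nbij' (fun p => (S.piecewise p.1 p.2, S.piecewise p.2 p.1))
    (fun p => (S.piecewise p.1 p.2, S.piecewise p.2 p.1)) ?_ ?_ ?_ ?_
  · rintro ⟨f, g⟩ h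
    simp only [coe_product, Set.mem_prod, mem_coe, mem_filter, Fintype.mem_piFinset] at h ⊢
    obtain ⟨⟨hf, hAf, hBf⟩, hg⟩ := h
    refine ⟨⟨hmem _ _ hf hg, hA f _ ?_ hAf⟩, ⟨hmem _ _ hg hf, hB f _ ?_ hBf⟩⟩
    · intro i hi; simp [hi]
    · intro i hi; simp [hi]
  · rintro ⟨f, g⟩ h
    simp only [coe_product, Set.mem_prod, mem_coe, mem_filter, Fintype.mem_piFinset] at h ⊢
    obtain ⟨⟨hf, hAf⟩, hg, hBg⟩ := h
    refine ⟨⟨hmem _ _ hf hg, hA f _ ?_ hAf, hB g _ ?_ hBg⟩, hmem _ _ hg hf⟩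
    · intro i hi; simp [hi]
    · intro i hi; simp [hi]
  · rintro ⟨f, g⟩ _; simp [key]
  · rintro ⟨f, g⟩ _; simp [key]

open Classical in
lemma up_indep {β : Type*} {m : ℕ} (K : Finset β) (hK : K.Nonempty) (S : Finset (Fin m))
    (A B : (Fin m → β) → Prop) [DecidablePred A] [DecidablePred B]
    (hA : ∀ f g, (∀ i ∈ S, f i = g i) → A f → A g)
    (hB : ∀ f g, (∀ i ∉ S, f i = g i) → B f → B g) :
    uprob (Fintype.piFinset fun _ : Fin m => K) (fun f => A f ∧ B f) =
    uprob (Fintype.piFinset fun _ : Fin m => K) A *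
    uprob (Fintype.piFinset fun _ : Fin m => K) B := by
  have h := indep K S A B hA hB
  have h0 : ((Fintype.piFinset fun _ : Fin m => K).card : ℝ) ≠ 0 := by
    have : (K.card : ℝ) ≠ 0 := by exact_mod_cast hK.card_pos.ne'
    rw [Fintype.card_piFinset]
    simp [hK.ne_empty]
  simp only [up_eq]
  have h' := congrArg (Nat.cast : ℕ → ℝ) h
  push_cast only [Nat.cast_mul] at h'
  field_simp
  exact h'

open Classical in
lemma up_cond {β : Type*} {m : ℕ} (K : Finset β) (S : Finset (Fin m))
    (A B : (Fin m → β) → Prop) [DecidablePred A] [DecidablePred B]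
    (hA : ∀ f g, (∀ i ∈ S, f i = g i) → A f → A g)
    (hB : ∀ f g, (∀ i ∉ S, f i = g i) → B f → B g)
    (hne : ((Fintype.piFinset fun _ : Fin m => K).filter A).Nonempty) :
    uprob ((Fintype.piFinset fun _ : Fin m => K).filter A) B =
    uprob (Fintype.piFinset fun _ : Fin m => K) B := by
  have h := indep K S A B hA hB
  have h1 : (((Fintype.piFinset fun _ : Fin m => K).filter A).card : ℝ) ≠ 0 := by
    have := hne.card_pos
    exact_mod_cast this.ne'
  have h0 : ((Fintype.piFinset fun _ : Fin m => K).card : ℝ) ≠ 0 := by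
    have := (hne.mono (filter_subset _ _)).card_pos
    exact_mod_cast this.ne'
  simp only [up_eq]
  rw [filter_filter]
  have h' := congrArg (Nat.cast : ℕ → ℝ) h
  rw [Nat.cast_mul, Nat.cast_mul] at h'
  rw [div_eq_div_iff h1 h0, h']
  ring

lemma exists_map {β ι : Type*} [DecidableEq ι] [Inhabited β] (S : Finset ι) :
    ∀ D : Multiset β, Multiset.card D = S.card → ∃ f : ι → β, Multiset.map f S.val = D := by
  induction S using Finset.induction_on with
  | empty => intro D h; simp at h; exact ⟨fun _ => default, by simp [h]⟩
  | insert a S ha ih =>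
    intro D h
    rw [card_insert_of_notMem ha] at h
    obtain ⟨b, hb⟩ := Multiset.card_pos_iff_exists_mem.1 (by omega : 0 < Multiset.card D)
    obtain ⟨D', rfl⟩ := Multiset.exists_cons_of_mem hb
    obtain ⟨f, hf⟩ := ih D' (by simpa using h)
    refine ⟨Function.update f a b, ?_⟩
    rw [insert_val_of_notMem ha, Multiset.map_cons, Function.update_self, ← hf]
    congr 1
    refine Multiset.map_congr rfl fun x hx => ?_
    rw [Function.update_of_ne]
    rintro rfl; exact ha hx

open Classical in
/-- Probability of a box. -/
lemma up_box {β : Type*} {m : ℕ} (K : Finset β) (X : Fin m → β → Prop) :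
    uprob (Fintype.piFinset fun _ : Fin m => K) (fun f => ∀ i, X i (f i)) =
      ∏ i, uprob K (X i) := by
  simp only [up_eq]
  rw [prod_div_distrib, Fintype.card_piFinset]
  have : ((Fintype.piFinset fun _ : Fin m => K).filter fun f => ∀ i, X i (f i)) =
      Fintype.piFinset fun i => K.filter (X i) := by
    ext f; simp [forall_and]
  rw [this, Fintype.card_piFinset]
  push_cast
  rfl

lemma up_true {β : Type*} (K : Finset β) (hK : K.Nonempty) : uprob K (fun _ => True) = 1 := by
  have : (K.card : ℝ) ≠ 0 := by exact_mod_cast hK.card_pos.ne'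
  simp [uprob, this]

open Classical in
lemma up_not {β : Type*} (K : Finset β) (hK : K.Nonempty) (E : β → Prop) :
    uprob K (fun x => ¬ E x) = 1 - uprob K E := by
  have : (K.card : ℝ) ≠ 0 := by exact_mod_cast hK.card_pos.ne'
  have h := card_filter_add_card_filter_not (s := K) E
  have h' := congrArg (Nat.cast : ℕ → ℝ) h
  push_cast at h'
  simp only [up_eq]
  field_simp
  linarith

open Classical in
lemma up_all {β : Type*} {m : ℕ} (K : Finset β) (hK : K.Nonempty) (E : β → Prop)
    (U : Finset (Fin m)) :
    uprob (Fintype.piFinset fun _ : Fin m => K) (fun f => ∀ i ∈ U, E (f i)) =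
      uprob K E ^ U.card := by
  rw [up_box K (fun i x => i ∈ U → E x)]
  have : ∀ i, uprob K (fun x => i ∈ U → E x) = if i ∈ U then uprob K E else 1 := by
    intro i
    split_ifs with h
    · simp [h]
    · simp [h, up_true K hK]
  simp [this]

open Classical in
lemma up_pattern {β : Type*} {m : ℕ} (K : Finset β) (hK : K.Nonempty) (E : β → Prop) [DecidablePred E]
    (T U : Finset (Fin m)) (hU : U ⊆ T) :
    uprob (Fintype.piFinset fun _ : Fin m => K) (fun f => (T.filter fun i => E (f i)) = U) =
      uprob K E ^ U.card * (1 - uprob K E) ^ (T.card - U.card) := by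
  have h1 : (fun f : Fin m → β => (T.filter fun i => E (f i)) = U) =
      fun f => ∀ i, (i ∈ T → (E (f i) ↔ i ∈ U)) := by
    funext f
    rw [eq_iff_iff, Finset.ext_iff]
    refine forall_congr' fun i => ?_
    have := @hU i
    simp only [mem_filter]
    tauto
  rw [h1, up_box K (fun i x => (i ∈ T → (E x ↔ i ∈ U)))]
  have : ∀ i, uprob K (fun x => i ∈ T → (E x ↔ i ∈ U)) =
      (if i ∈ U then uprob K E else 1) * (if i ∈ T \ U then 1 - uprob K E else 1) := by
    intro i
    by_cases hi : i ∈ U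
    · simp [hi, hU hi]
    · by_cases ht : i ∈ T
      · simp [hi, ht, up_not K hK]
      · simp [hi, ht, up_true K hK]
  simp only [this, prod_mul_distrib]
  rw [← card_sdiff_of_subset hU]
  rw [prod_ite_mem, prod_ite_mem]
  simp

open Classical in
lemma up_binom {β : Type*} {m : ℕ} (K : Finset β) (hK : K.Nonempty) (E : β → Prop) [DecidablePred E]
    (T : Finset (Fin m)) (θ : ℕ) :
    uprob (Fintype.piFinset fun _ : Fin m => K)
      (fun f => θ ≤ (T.filter fun i => E (f i)).card) ≤ binomProbGe T.card (uprob K E) θ := by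
  have h1 : (fun f : Fin m → β => θ ≤ (T.filter fun i => E (f i)).card) =
      fun f => ∃ U ∈ (Icc θ T.card).biUnion (fun j => powersetCard j T),
        (T.filter fun i => E (f i)) = U := by
    funext f
    simp only [eq_iff_iff, exists_eq_right', mem_biUnion, mem_Icc, mem_powersetCard]
    constructor
    · intro h
      exact ⟨_, ⟨h, card_le_card (filter_subset _ _)⟩, filter_subset _ _, rfl⟩
    · rintro ⟨j, ⟨h, _⟩, _, rfl⟩; exact h
  rw [h1]
  refine (up_exists _ _ _).trans ?_
  rw [sum_biUnion]
  · unfold binomProbGe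
    refine (sum_congr rfl fun j hj => ?_).le
    rw [sum_congr rfl (g := fun _ => uprob K E ^ j * (1 - uprob K E) ^ (T.card - j))]
    · simp [mul_assoc]
    · intro U hU
      rw [mem_powersetCard] at hU
      rw [up_pattern K hK E T U hU.1, hU.2]
  · intro i _ j _ hij
    exact pairwise_disjoint_powersetCard T hij

open Classical in
lemma up_mem (n k : ℕ) (hkn : k < n) (v : Fin n) :
    uprob (kSets n k) (fun A => v ∈ A) = (k : ℝ) / n := by
  have hn : (n : ℝ) ≠ 0 := by exact_mod_cast (by omega : n ≠ 0)
  have hN : (n.choose k : ℝ) ≠ 0 := by exact_mod_cast (Nat.choose_pos hkn.le).ne'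
  have hne : (kSets n k).Nonempty := by
    rw [← card_pos]; simpa [kSets] using Nat.choose_pos hkn.le
  have h := up_not (kSets n k) hne (fun A => v ∈ A)
  have h2 : ((kSets n k).filter fun A => ¬ v ∈ A) = powersetCard k (univ.erase v) := by
    ext A
    simp only [kSets, mem_filter, mem_powersetCard, subset_univ, true_and, subset_erase]
    tauto
  simp only [up_eq] at h ⊢
  rw [h2, card_powersetCard, card_erase_of_mem (mem_univ v)] at h
  simp only [kSets, card_powersetCard, card_univ, Fintype.card_fin] at h ⊢
  have h3 : n.choose k * (n - k) = n * (n - 1).choose k := by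
    obtain ⟨n, rfl⟩ : ∃ j, n = j + 1 := ⟨n - 1, by omega⟩
    have := Nat.add_one_mul_choose_eq n k
    have h4 := Nat.choose_succ_right_eq (n+1) k
    simp at *
    rw [← h4, this]
  have h3' : (n.choose k : ℝ) * (n - k) = n * (n - 1).choose k := by
    rw [← Nat.cast_sub hkn.le]; exact_mod_cast h3
  have h5 : ((n - 1).choose k : ℝ) / n.choose k = 1 - k / n := by
    field_simp; linarith
  rw [h5] at h
  linarith

end CMD

/-- **Proposition.** Let `A_1,…,A_m` be independent uniform `k`-subsets of `[n]`, `Δ` the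
maximum degree of the multiset `{A_1,…,A_m}`, `s ∈ [m]`, `t = m - s`, `S ∈ C([m],s)` and `D`
an `s`-element multiset of `k`-subsets of `[n]` of maximum degree at most `C`.  If
`Pr(Bin(t,k/n) ≥ α - C) = ρ/n`, then
`|Pr(Δ ≤ α | {A_i : i ∈ S} = D) - Pr(Δ ≤ α)| ≤ s k ρ/n + n (s k/n)^{C+1}`. -/
theorem conditioned_maxDegree_comparison
    (n k m : ℕ) (hnk : 2 * k < n)
    (α C s : ℕ) (hα : 0 < α) (hC : 0 < C) (hs1 : 1 ≤ s) (hsm : s ≤ m)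
    (S : Finset (Fin m)) (hS : S.card = s)
    (D : Multiset (Finset (Fin n))) (hD : Multiset.card D = s)
    (hDk : ∀ A ∈ D, A ∈ kSets n k)
    (hDC : ∀ v : Fin n, Multiset.card (D.filter (fun A => v ∈ A)) ≤ C)
    (ρ : ℝ) (hρ : binomProbGe (m - s) ((k : ℝ) / n) (α - C) = ρ / n) :
    |uprob ((Finset.univ : Finset (Fin m → Finset (Fin n))).filter
          (fun f => (∀ i, f i ∈ kSets n k) ∧ Multiset.map f S.val = D))
        (fun f => ∀ v : Fin n, tdeg f v ≤ α) -
      uprob ((Finset.univ : Finset (Fin m → Finset (Fin n))).filter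
          (fun f => ∀ i, f i ∈ kSets n k))
        (fun f => ∀ v : Fin n, tdeg f v ≤ α)| ≤
      (s : ℝ) * k * ρ / n + (n : ℝ) * ((s : ℝ) * k / n) ^ (C + 1) := by
  classical
  have hkn : k < n := by omega
  set K := kSets n k with hKdef
  have hK : K.Nonempty := by
    rw [← Finset.card_pos]; simpa [hKdef, kSets] using Nat.choose_pos hkn.le
  set Ω := Fintype.piFinset fun _ : Fin m => K with hΩ
  have e1 : ((Finset.univ : Finset (Fin m → Finset (Fin n))).filter
      (fun f => ∀ i, f i ∈ K)) = Ω := by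
    ext f; simp [hΩ]
  have e2 : ((Finset.univ : Finset (Fin m → Finset (Fin n))).filter
      (fun f => (∀ i, f i ∈ K) ∧ Multiset.map f S.val = D)) =
      Ω.filter (fun f => Multiset.map f S.val = D) := by
    ext f; simp [hΩ]
  rw [e1, e2]
  set A : (Fin m → Finset (Fin n)) → Prop := fun f => Multiset.map f S.val = D with hAdef
  have hA : ∀ f g, (∀ i ∈ S, f i = g i) → A f → A g := by
    intro f g h hf
    simp only [hAdef] at hf ⊢
    rw [← hf]
    exact Multiset.map_congr rfl fun x hx => (h x hx).symm
  have hne : (Ω.filter A).Nonempty := by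
    obtain ⟨A0, hA0⟩ := hK
    obtain ⟨f, hf⟩ := CMD.exists_map S D (hD.trans hS.symm)
    refine ⟨fun i => if i ∈ S then f i else A0, ?_⟩
    rw [Finset.mem_filter]
    refine ⟨?_, hA f _ (by intro i hi; simp [hi]) hf⟩
    rw [hΩ, Fintype.mem_piFinset]
    intro i
    by_cases hi : i ∈ S
    · simp only [hi, if_true]
      apply hDk
      rw [← hf]
      exact Multiset.mem_map_of_mem f hi
    · simpa [hi] using hA0
  let d : (Fin m → Finset (Fin n)) → Fin n → ℕ := fun f v => (Sᶜ.filter fun i => v ∈ f i).card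
  let e : (Fin m → Finset (Fin n)) → Fin n → ℕ := fun f v => (S.filter fun i => v ∈ f i).card
  have hde : ∀ f v, tdeg f v = e f v + d f v := by
    intro f v
    simp only [tdeg, e, d]
    rw [← Finset.card_union_of_disjoint, ← Finset.filter_union, Finset.union_compl]
    exact Finset.disjoint_filter_filter disjoint_compl_right
  have hd : ∀ f g, (∀ i ∉ S, f i = g i) → ∀ v, d f v = d g v := by
    intro f g h v
    simp only [d]
    congr 1
    refine Finset.filter_congr fun i hi => ?_
    rw [h i (by simpa using hi)]
  have heD : ∀ f, A f → ∀ v, e f v = Multiset.card (D.filter (fun A => v ∈ A)) := by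
    intro f hf v
    simp only [hAdef] at hf
    rw [← hf, Multiset.filter_map, Multiset.card_map]
    rfl
  set β := α - C with hβ
  have hnpos : (0 : ℝ) < n := by exact_mod_cast (by omega : 0 < n)
  -- the tail
  have htail : ∀ v, uprob Ω (fun f => β ≤ d f v) ≤ ρ / n := by
    intro v
    rw [← hρ]
    have h := CMD.up_binom (m := m) K hK (fun A => v ∈ A) Sᶜ β
    rw [CMD.up_mem n k hkn v, Finset.card_compl, hS, Fintype.card_fin] at h
    exact h
  have hρ0 : 0 ≤ ρ / n := (CMD.up_nonneg Ω _).trans (htail ⟨0, by omega⟩)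
  have htailD : ∀ v, uprob (Ω.filter A) (fun f => β ≤ d f v) ≤ ρ / n := by
    intro v
    rw [hΩ, CMD.up_cond K S A _ hA _ hne]
    · exact htail v
    · intro f g h hf
      rw [← hd f g h]; exact hf
  set p0 := uprob Ω (fun f => ∀ v, d f v ≤ α) with hp0
  have hp0D : uprob (Ω.filter A) (fun f => ∀ v, d f v ≤ α) = p0 := by
    rw [hp0, hΩ, CMD.up_cond K S A _ hA _ hne]
    intro f g h hf v
    rw [← hd f g h]; exact hf v
  have u1 : uprob (Ω.filter A) (fun f => ∀ v : Fin n, tdeg f v ≤ α) ≤ p0 := by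
    rw [← hp0D]
    refine CMD.up_mono _ _ _ fun f _ h v => ?_
    have := h v; rw [hde] at this; omega
  have u2 : uprob Ω (fun f => ∀ v : Fin n, tdeg f v ≤ α) ≤ p0 := by
    refine CMD.up_mono _ _ _ fun f _ h v => ?_
    have := h v; rw [hde] at this; omega
  -- lower bound, conditioned
  have l1 : p0 ≤ uprob (Ω.filter A) (fun f => ∀ v : Fin n, tdeg f v ≤ α) +
      (s : ℝ) * k * ρ / n := by
    let V : Finset (Fin n) := D.toFinset.biUnion id
    have hV : V.card ≤ s * k := by
      refine (Finset.card_biUnion_le_card_mul _ _ k ?_).trans ?_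
      · intro B hB
        have := hDk B (by simpa using hB)
        simp only [hKdef, kSets, Finset.mem_powersetCard] at this
        simp [this.2]
      · gcongr
        rw [← hD]; exact Multiset.toFinset_card_le D
    rw [← hp0D]
    refine (CMD.up_mono _ _ (fun f => (∀ v : Fin n, tdeg f v ≤ α) ∨ ∃ v ∈ V, β ≤ d f v)
      ?_).trans ((CMD.up_or _ _ _).trans ?_)
    · intro f hf h
      rw [Finset.mem_filter] at hf
      by_contra! hcon
      obtain ⟨⟨v, hv⟩, h2⟩ := hcon
      rw [hde, heD f hf.2] at hv
      have h3 := hDC v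
      have h4 := h v
      have hvV : v ∈ V := by
        have : 0 < Multiset.card (D.filter (fun A => v ∈ A)) := by omega
        obtain ⟨B, hB⟩ := Multiset.card_pos_iff_exists_mem.1 this
        rw [Multiset.mem_filter] at hB
        simp only [V, Finset.mem_biUnion, Multiset.mem_toFinset, id]
        exact ⟨B, hB⟩
      have := h2 v hvV
      omega
    · gcongr
      refine (CMD.up_exists _ _ _).trans ?_
      refine (Finset.sum_le_sum fun v _ => htailD v).trans ?_
      rw [Finset.sum_const, nsmul_eq_mul, mul_div_assoc]
      gcongr
      exact_mod_cast hV
  have l2 : p0 ≤ uprob Ω (fun f => ∀ v : Fin n, tdeg f v ≤ α) +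
      ((s : ℝ) * k * ρ / n + (n : ℝ) * ((s : ℝ) * k / n) ^ (C + 1)) := by
    refine (CMD.up_mono _ _ (fun f => (∀ v : Fin n, tdeg f v ≤ α) ∨
      ((∃ iv ∈ S ×ˢ (Finset.univ : Finset (Fin n)), iv.2 ∈ f iv.1 ∧ β ≤ d f iv.2) ∨
        ∃ vU ∈ (Finset.univ : Finset (Fin n)) ×ˢ Finset.powersetCard (C + 1) S,
          ∀ i ∈ vU.2, vU.1 ∈ f i))
      ?_).trans ((CMD.up_or _ _ _).trans ?_)
    · intro f hf h
      by_contra! hcon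
      obtain ⟨⟨v, hv⟩, h2, h3⟩ := hcon
      rw [hde] at hv
      have h4 := h v
      have he : 0 < e f v := by omega
      obtain ⟨i, hi⟩ := Finset.card_pos.1 he
      rw [Finset.mem_filter] at hi
      have h5 := h2 (i, v) (by simp [hi.1]) hi.2
      have h6 : C + 1 ≤ e f v := by simp only at h5; omega
      obtain ⟨U, hU, hUc⟩ := Finset.exists_subset_card_eq h6
      obtain ⟨j, hj, hj2⟩ := h3 (v, U) (by
        simp only [Finset.mem_product, Finset.mem_univ, true_and, Finset.mem_powersetCard]
        exact ⟨hU.trans (Finset.filter_subset _ _), hUc⟩)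
      exact hj2 (Finset.mem_filter.1 (hU hj)).2
    · gcongr
      refine (CMD.up_or _ _ _).trans (add_le_add ?_ ?_)
      · refine (CMD.up_exists _ _ _).trans ?_
        refine (Finset.sum_le_sum (g := fun _ => (k : ℝ) / n * (ρ / n)) fun iv hiv => ?_).trans ?_
        · rw [Finset.mem_product] at hiv
          rw [hΩ, CMD.up_indep K hK S (fun f => iv.2 ∈ f iv.1) (fun f => β ≤ d f iv.2)]
          · have h1 := CMD.up_all (m := m) K hK (fun A => iv.2 ∈ A) {iv.1}
            simp only [Finset.mem_singleton, forall_eq, Finset.card_singleton, pow_one] at h1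
            rw [h1, CMD.up_mem n k hkn]
            gcongr
            exact htail _
          · intro f g h hf
            rw [← h _ hiv.1]; exact hf
          · intro f g h hf
            rw [← hd f g h]; exact hf
        · rw [Finset.sum_const, nsmul_eq_mul, Finset.card_product, hS, Finset.card_univ,
            Fintype.card_fin]
          push_cast
          apply le_of_eq
          field_simp
      · refine (CMD.up_exists _ _ _).trans ?_
        refine (Finset.sum_le_sum (g := fun _ => ((k : ℝ) / n) ^ (C + 1))
          fun vU hvU => ?_).trans ?_
        · rw [Finset.mem_product, Finset.mem_powersetCard] at hvU
          rw [hΩ, CMD.up_all (m := m) K hK (fun A => vU.1 ∈ A) vU.2, CMD.up_mem n k hkn, hvU.2.2]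
        · rw [Finset.sum_const, nsmul_eq_mul, Finset.card_product, Finset.card_powersetCard, hS,
            Finset.card_univ, Fintype.card_fin, mul_div_assoc, mul_pow]
          push_cast
          rw [mul_assoc]
          gcongr
          exact_mod_cast Nat.choose_le_pow s (C + 1)
  have hX : 0 ≤ (n : ℝ) * ((s : ℝ) * k / n) ^ (C + 1) := by positivity
  rw [abs_le]
  constructor <;> linarith
end
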